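/- Let L be a finite relational language all of whose relation symbols are unary or binary, and let F be a finite set of finite irreducible L-structures. Then every Forb_e(F)-universal countably infinite L-structure U has finite big Ramsey degrees; that is, for every finite substructure A of U there exists a finite D = D(A) such that U ⟶ (U)^A_{k,D} for every k ≥ 1. -/

import Mathlib

/-!
Statement 0 (Zucker's theorem): Let `L` be a finite relational language all of whose relation
symbols are unary or binary, and let `F` be a finite set of finite irreducible `L`-structures.
Then every `Forb_e(F)`-universal countably infinite `L`-structure `U` has finite big Ramsey
degrees: for every finite substructure `A` of `U` there is a finite `D = D(A)` such that
`U ⟶ (U)^A_{k,D}` for every `k ≥ 1`.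
-/

open FirstOrder FirstOrder.Language

/-- A bundled `L`-structure. -/
structure FOStr (L : FirstOrder.Language.{0, 0}) : Type 1 where
  carrier : Type
  str : L.Structure carrier

instance {L : FirstOrder.Language.{0, 0}} (M : FOStr L) : L.Structure M.carrier := M.str

/-- An `L`-structure is irreducible if every pair of vertices lies in a common tuple of some
relation. -/
def Irred (L : FirstOrder.Language.{0, 0}) (A : Type) [L.Structure A] : Prop :=
  ∀ u v : A, ∃ (n : ℕ) (R : L.Relations n) (t : Fin n → A),
    Structure.RelMap R t ∧ (∃ a, t a = u) ∧ (∃ b, t b = v)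

/-- `B` is `F`-free: no member of the family `F` embeds into `B`. -/
def FFree {L : FirstOrder.Language.{0, 0}} {ι : Type} (F : ι → FOStr L) (B : Type) [L.Structure B] : Prop :=
  ∀ i, IsEmpty ((F i).carrier ↪[L] B)

/-- `C ⟶ (B)^A_{k,l}`: for every colouring of the embeddings of `A` into `C` with `k` colours
there is an embedding `f : B ↪ C` such that the embeddings of `A` into `C` with range inside
`f[B]` receive at most `l` colours. -/
def Arrow (L : FirstOrder.Language.{0, 0}) (C B A : Type) [L.Structure C] [L.Structure B] [L.Structure A]
    (k l : ℕ) : Prop :=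
  ∀ χ : (A ↪[L] C) → Fin k, ∃ f : B ↪[L] C,
    Set.ncard { c : Fin k | ∃ e : A ↪[L] C, Set.range ⇑e ⊆ Set.range ⇑f ∧ χ e = c } ≤ l

section Part1

open Cardinal

/-- Large families of partial functions contain infinite compatible subfamilies. -/
theorem BR_compat_family (M : Type) [Infinite M] (J V : Type) (hV : #V ≤ 2 ^ #M)
    (q : Set (Set M) → J → Option V) (e : Set (Set M) → M → J)
    (he : ∀ y j, q y j ≠ none → ∃ a, e y a = j) :
    ∃ H : Set (Set (Set M)), H.Infinite ∧ ∀ y ∈ H, ∀ y' ∈ H, ∀ j v v',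
      q y j = some v → q y' j = some v' → v = v' := by
  classical
  set Rel : Set J := Set.range (fun x : Set (Set M) × M => e x.1 x.2) with hRel
  have hm : ℵ₀ ≤ #M := Cardinal.aleph0_le_mk M
  have h1 : #M ≤ 2 ^ #M := (Cardinal.cantor _).le
  have h2 : (2:Cardinal) ^ #M ≤ 2 ^ (2 ^ #M : Cardinal) := (Cardinal.cantor _).le
  have hcard : #Rel ≤ #(Set (Set M)) := by
    refine Cardinal.mk_range_le.trans ?_
    simp only [Cardinal.mk_prod, Cardinal.lift_id, Cardinal.mk_set]
    calc (2:Cardinal) ^ (2 ^ #M : Cardinal) * #M ≤ 2 ^ (2 ^ #M : Cardinal) * 2 ^ (2 ^ #M : Cardinal) := by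
          gcongr; exact h1.trans h2
      _ = 2 ^ (2 ^ #M : Cardinal) := Cardinal.mul_eq_self (hm.trans (h1.trans h2))
  obtain ⟨emb⟩ := Cardinal.le_def _ _ |>.1 hcard
  let io : J → Set (Set M) := fun j => if h : j ∈ Rel then emb ⟨j, h⟩ else ∅
  have hio : ∀ j ∈ Rel, ∀ j' ∈ Rel, io j = io j' → j = j' := by
    intro j hj j' hj' h
    simp only [io, hj, hj', dif_pos] at h
    have := emb.injective h
    simpa using this
  have hsep : ∀ y (a b : M), ∃ x : Set M, e y a ≠ e y b →
      ¬ (x ∈ io (e y a) ↔ x ∈ io (e y b)) := by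
    intro y a b
    by_cases h : e y a = e y b
    · exact ⟨∅, fun h' => absurd h h'⟩
    · have : io (e y a) ≠ io (e y b) := fun h' => h (hio _ ⟨(y, a), rfl⟩ _ ⟨(y, b), rfl⟩ h')
      by_contra hcon
      push Not at hcon
      exact this (Set.ext fun x => (hcon x).2)
  choose n hn using hsep
  let name : Set (Set M) → (M → M → Set M) × (M → M → M → Prop) × (M → Option V) := fun y =>
    (n y, (fun a b c => n y b c ∈ io (e y a)), (fun a => q y (e y a)))
  have hpow : ∀ c : Cardinal, c ≤ 2 ^ #M → c ^ #M ≤ 2 ^ #M := by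
    intro c hc
    calc c ^ #M ≤ (2 ^ #M) ^ #M := Cardinal.power_le_power_right hc
      _ = 2 ^ #M := by rw [← Cardinal.power_mul, Cardinal.mul_eq_self hm]
  have hmul : ∀ c d : Cardinal, c ≤ 2 ^ #M → d ≤ 2 ^ #M → c * d ≤ 2 ^ #M := by
    intro c d hc hd
    calc c * d ≤ 2 ^ #M * 2 ^ #M := by gcongr
      _ = 2 ^ #M := Cardinal.mul_eq_self (hm.trans h1)
  have hname : #((M → M → Set M) × (M → M → M → Prop) × (M → Option V)) ≤ 2 ^ #M := by
    have a1 : #(M → M → Set M) ≤ 2 ^ #M := by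
      rw [← Cardinal.power_def, ← Cardinal.power_def, Cardinal.mk_set]
      exact hpow _ (hpow _ le_rfl)
    have a2 : #(M → M → M → Prop) ≤ 2 ^ #M := by
      rw [← Cardinal.power_def, ← Cardinal.power_def, ← Cardinal.power_def]
      refine hpow _ (hpow _ (hpow _ ?_))
      simp only [Cardinal.mk_Prop]
      exact (Cardinal.natCast_lt_aleph0 (n := 2)).le.trans (hm.trans h1)
    have a3 : #(M → Option V) ≤ 2 ^ #M := by
      rw [← Cardinal.power_def, Cardinal.mk_option]
      refine hpow _ ?_
      exact Cardinal.add_le_of_le (hm.trans h1) hV ((Cardinal.one_lt_aleph0).le.trans (hm.trans h1))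
    simp only [Cardinal.mk_prod, Cardinal.lift_id]
    exact hmul _ _ a1 (hmul _ _ a2 a3)
  obtain ⟨N, hN⟩ := Cardinal.exists_infinite_fiber name
    (hname.trans_lt (by
      rw [Cardinal.mk_set, Cardinal.mk_set]; exact Cardinal.cantor _))
  refine ⟨name ⁻¹' {N}, Set.infinite_coe_iff.1 hN, ?_⟩
  intro y hy y' hy' j v v' hv hv'
  have hnm : name y = name y' := by
    rw [Set.mem_preimage, Set.mem_singleton_iff] at hy hy'
    rw [hy, hy']
  obtain ⟨a, ha⟩ := he y j (by rw [hv]; simp)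
  obtain ⟨a', ha'⟩ := he y' j (by rw [hv']; simp)
  have e1 : n y = n y' := congrArg Prod.fst hnm
  have e2 : ∀ a b c, (n y b c ∈ io (e y a)) = (n y' b c ∈ io (e y' a)) := by
    intro a b c
    exact congrFun (congrFun (congrFun (congrArg (fun x => x.2.1) hnm) a) b) c
  have e3 : ∀ a, q y (e y a) = q y' (e y' a) := fun a => congrFun (congrArg (fun x => x.2.2) hnm) a
  have key : e y a = e y a' := by
    by_contra hne
    refine hn y a a' hne ?_
    have := e2 a' a a'
    rw [this, ha', ha, e1]
  have : q y j = q y' j := by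
    have hj : e y a' = j := key.symm.trans ha
    have h3 := e3 a'
    rwa [hj, ha'] at h3
  rw [hv, hv'] at this
  exact Option.some.inj this

/-- Polarised version over a finite index type. -/
theorem BR_polar (C : Type) [Finite C] : ∃ X : C → Type, (∀ c, Infinite (X c)) ∧
    ∀ (J V : Type) (_ : Nonempty J) (_ : #V ≤ 2 ^ ℵ₀) (p : (∀ c, X c) → J → Option V)
      (_ : ∀ α, {j | p α j ≠ none}.Countable),
      ∃ H : ∀ c, Set (X c), (∀ c, (H c).Infinite) ∧ ∀ α β, (∀ c, α c ∈ H c) → (∀ c, β c ∈ H c) →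
        ∀ j v v', p α j = some v → p β j = some v' → v = v' := by
  classical
  revert C
  apply Finite.induction_empty_option
  · intro C C' e ⟨X, hX, h⟩
    refine ⟨fun c' => X (e.symm c'), fun c' => hX _, ?_⟩
    intro J V hJ hV p hp
    obtain ⟨H, hH, hc⟩ := h J V hJ hV (fun α => p (fun c' => α (e.symm c'))) (fun α => hp _)
    refine ⟨fun c' => H (e.symm c'), fun c' => hH _, ?_⟩
    intro α β hα hβ j v v' h1 h2
    obtain ⟨α', rfl⟩ := (Equiv.piCongrLeft' X e).surjective α
    obtain ⟨β', rfl⟩ := (Equiv.piCongrLeft' X e).surjective β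
    refine hc α' β' ?_ ?_ j v v' h1 h2
    · intro c
      have key : ∀ c'', c'' = c → α' c'' ∈ H c'' → α' c ∈ H c := by
        rintro _ rfl h
        exact h
      exact key _ (e.symm_apply_apply c) (hα (e c))
    · intro c
      have key : ∀ c'', c'' = c → β' c'' ∈ H c'' → β' c ∈ H c := by
        rintro _ rfl h
        exact h
      exact key _ (e.symm_apply_apply c) (hβ (e c))
  · refine ⟨fun c => c.elim, fun c => c.elim, ?_⟩
    intro J V hJ hV p hp
    refine ⟨fun c => c.elim, fun c => c.elim, ?_⟩
    intro α β hα hβ j v v' h1 h2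
    have : α = β := funext fun c => c.elim
    subst this
    rw [h1] at h2
    exact Option.some.inj h2
  · intro C _ ⟨X, hX, h⟩
    have : ∀ c, Nonempty (X c) := fun c => inferInstance
    let M := (∀ c, X c) × ℕ
    have hM : Infinite M := by infer_instance
    let X' : Option C → Type := fun o => Option.rec (Set (Set M)) X o
    let ev : (∀ o, X' o) ≃ Set (Set M) × ∀ c, X c := Equiv.piOptionEquivProd (β := X')
    refine ⟨X', ?_, ?_⟩
    · rintro (_ | c)
      · change Infinite (Set (Set M))
        infer_instance
      · exact hX c
    intro J V hJ hV p hp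
    have hnum : ∀ α, ∃ f : ℕ → J, ∀ j, p α j ≠ none → ∃ n, f n = j := by
      intro α
      by_cases hne : {j | p α j ≠ none}.Nonempty
      · obtain ⟨f, hf⟩ := (hp α).exists_eq_range hne
        refine ⟨f, fun j hj => ?_⟩
        have : j ∈ Set.range f := hf ▸ hj
        exact this
      · exact ⟨fun _ => hJ.some, fun j hj => (hne ⟨j, hj⟩).elim⟩
    choose f hf using hnum
    obtain ⟨HY, hHY, hc⟩ := BR_compat_family M ((∀ c, X c) × J) V
      (hV.trans (Cardinal.power_le_power_left two_ne_zero (Cardinal.aleph0_le_mk M)))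
      (fun y aj => p (ev.symm (y, aj.1)) aj.2) (fun y m => (m.1, f (ev.symm (y, m.1)) m.2))
      (by
        rintro y ⟨α, j⟩ hj
        obtain ⟨n, hn⟩ := hf _ j hj
        exact ⟨(α, n), by simp [hn]⟩)
    let b : ℕ ↪ HY := hHY.natEmbedding
    let P : (∀ c, X c) → J → Option V := fun α j =>
      if hh : ∃ n v, p (ev.symm ((b n).1, α)) j = some v then some hh.choose_spec.choose else none
    have hP : ∀ α j n v, p (ev.symm ((b n).1, α)) j = some v → P α j = some v := by
      intro α j n v hv
      have hh : ∃ n v, p (ev.symm ((b n).1, α)) j = some v := ⟨n, v, hv⟩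
      simp only [P, hh, dif_pos]
      congr 1
      exact hc _ (b hh.choose).2 _ (b n).2 (α, j) _ _ hh.choose_spec.choose_spec hv
    obtain ⟨H, hH, hcc⟩ := h J V hJ hV P (by
      intro α
      refine Set.Countable.mono ?_ (Set.countable_iUnion (fun n : ℕ => hp (ev.symm ((b n).1, α))))
      intro j hj
      simp only [Set.mem_ofPred_eq, P] at hj
      split_ifs at hj with hh
      · obtain ⟨n, v, hv⟩ := hh
        simp only [Set.mem_iUnion, Set.mem_ofPred_eq]
        exact ⟨n, by rw [hv]; simp⟩
      · exact (hj rfl).elim)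
    let H' : ∀ o, Set (X' o) := fun o =>
      Option.rec (motive := fun o => Set (X' o)) (Set.range fun n => (b n).1) H o
    refine ⟨H', ?_, ?_⟩
    · rintro (_ | c)
      · exact Set.infinite_range_of_injective (fun m n hmn => b.injective (Subtype.ext hmn))
      · exact hH c
    intro α β hα hβ j v v' h1 h2
    obtain ⟨n, hn⟩ := hα none
    obtain ⟨n', hn'⟩ := hβ none
    have ha : ev.symm ((b n).1, fun c => α (some c)) = α := by
      rw [Equiv.symm_apply_eq]; exact Prod.ext hn rfl
    have hb : ev.symm ((b n').1, fun c => β (some c)) = β := by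
      rw [Equiv.symm_apply_eq]; exact Prod.ext hn' rfl
    refine hcc (fun c => α (some c)) (fun c => β (some c)) (fun c => hα (some c)) (fun c => hβ (some c)) j v v' ?_ ?_
    · exact hP _ _ n _ (by rw [ha]; exact h1)
    · exact hP _ _ n' _ (by rw [hb]; exact h2)

end Part1

section Part2

/-- Abstract binary labelled system with a list of forbidden cliques. -/
structure BRSys where
  υ : Type
  σ : Type
  fυ : Finite υ
  fσ : Finite σ
  zero : σ
  sw : σ → σ
  sw_zero : sw zero = zero
  Bad : ∀ n : ℕ, (Fin n → υ) → (Fin n → Fin n → σ) → Prop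
  K : ℕ
  bad_le : ∀ n u l, Bad n u l → n ≤ K

namespace BRSys

variable {S : BRSys}

instance : Finite S.υ := S.fυ
instance : Finite S.σ := S.fσ

/-- A node: a unary type and a sequence of labels towards earlier vertices. -/
abbrev Node (S : BRSys) := S.υ × (ℕ → S.σ)

/-- labels on levels together with extra vertices -/
def lab {W : Type} (q : ℕ → S.Node) (s : W → S.Node) (l : W → W → S.σ) : ℕ ⊕ W → ℕ ⊕ W → S.σ
  | Sum.inl i, Sum.inl j => if i < j then (q j).2 i else if j < i then S.sw ((q i).2 j) else S.zero
  | Sum.inl i, Sum.inr w => (s w).2 i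
  | Sum.inr w, Sum.inl i => S.sw ((s w).2 i)
  | Sum.inr w, Sum.inr w' => l w w'

/-- unary types -/
def un {W : Type} (q : ℕ → S.Node) (s : W → S.Node) : ℕ ⊕ W → S.υ
  | Sum.inl i => (q i).1
  | Sum.inr w => (s w).1

/-- The family `s` with mutual labels `l` over the first `ℓ` levels of `q` has no bad clique. -/
def OK {W : Type} (q : ℕ → S.Node) (ℓ : ℕ) (s : W → S.Node) (l : W → W → S.σ) : Prop :=
  ∀ (n : ℕ) (f : Fin n → ℕ ⊕ W), (∀ a i, f a = Sum.inl i → i < ℓ) →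
    (∀ a b, a ≠ b → lab q s l (f a) (f b) ≠ S.zero) →
    ¬ S.Bad n (fun a => un q s (f a)) (fun a b => lab q s l (f a) (f b))

theorem OK.transfer {W W' : Type} {q q' : ℕ → S.Node} {ℓ ℓ' : ℕ} {s : W → S.Node} {s' : W' → S.Node}
    {l : W → W → S.σ} {l' : W' → W' → S.σ} (h : OK q ℓ s l)
    (H : ∀ (n : ℕ) (f : Fin n → ℕ ⊕ W'), (∀ a i, f a = Sum.inl i → i < ℓ') →
      (∀ a b, a ≠ b → lab q' s' l' (f a) (f b) ≠ S.zero) →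
      ∃ f' : Fin n → ℕ ⊕ W, (∀ a i, f' a = Sum.inl i → i < ℓ) ∧
        (∀ a, un q' s' (f a) = un q s (f' a)) ∧
        ∀ a b, lab q' s' l' (f a) (f b) = lab q s l (f' a) (f' b)) :
    OK q' ℓ' s' l' := by
  intro n f h1 h2 h3
  obtain ⟨f', g1, g2, g3⟩ := H n f h1 h2
  refine h n f' g1 (fun a b hab => ?_) ?_
  · rw [← g3]; exact h2 a b hab
  · simp only [g2, g3] at h3; exact h3

theorem OK.transfer_map {W W' : Type} {q q' : ℕ → S.Node} {ℓ ℓ' : ℕ} {s : W → S.Node} {s' : W' → S.Node}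
    {l : W → W → S.σ} {l' : W' → W' → S.σ} (h : OK q ℓ s l) (φ : ℕ ⊕ W' → ℕ ⊕ W)
    (hφ : ∀ x, (∀ i, x = Sum.inl i → i < ℓ') → (∀ i, φ x = Sum.inl i → i < ℓ) ∧ un q' s' x = un q s (φ x) ∧
      ∀ y, (∀ i, y = Sum.inl i → i < ℓ') → lab q' s' l' x y = lab q s l (φ x) (φ y)) :
    OK q' ℓ' s' l' :=
  h.transfer fun n f h1 _ => ⟨φ ∘ f, fun a => (hφ (f a) (h1 a)).1, fun a => (hφ (f a) (h1 a)).2.1,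
    fun a b => (hφ (f a) (h1 a)).2.2 _ (h1 b)⟩

/-- agreement below a level -/
def Agr (ℓ : ℕ) (s t : S.Node) : Prop := s.1 = t.1 ∧ ∀ i < ℓ, s.2 i = t.2 i

theorem Agr.refl (ℓ : ℕ) (s : S.Node) : Agr ℓ s s := ⟨rfl, fun _ _ => rfl⟩
theorem Agr.symm {ℓ : ℕ} {s t : S.Node} (h : Agr ℓ s t) : Agr ℓ t s :=
  ⟨h.1.symm, fun i hi => (h.2 i hi).symm⟩
theorem Agr.trans {ℓ : ℕ} {s t u : S.Node} (h : Agr ℓ s t) (h' : Agr ℓ t u) : Agr ℓ s u :=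
  ⟨h.1.trans h'.1, fun i hi => (h.2 i hi).trans (h'.2 i hi)⟩
theorem Agr.mono {ℓ ℓ' : ℕ} {s t : S.Node} (h : Agr ℓ s t) (hl : ℓ' ≤ ℓ) : Agr ℓ' s t :=
  ⟨h.1, fun i hi => h.2 i (hi.trans_le hl)⟩

/-- vanishing from a level on -/
def Nrm (ℓ : ℕ) (s : S.Node) : Prop := ∀ i, ℓ ≤ i → s.2 i = S.zero

theorem Nrm.mono {ℓ ℓ' : ℕ} {s : S.Node} (h : Nrm ℓ s) (hl : ℓ ≤ ℓ') : Nrm ℓ' s :=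
  fun i hi => h i (hl.trans hi)

/-- truncation -/
def trunc (ℓ : ℕ) (s : S.Node) : S.Node := (s.1, fun i => if i < ℓ then s.2 i else S.zero)

theorem trunc_nrm (ℓ : ℕ) (s : S.Node) : Nrm ℓ (trunc ℓ s) := by
  intro i hi; simp [trunc, Nat.not_lt.2 hi]
theorem trunc_agr (ℓ : ℕ) (s : S.Node) : Agr ℓ (trunc ℓ s) s :=
  ⟨rfl, fun i hi => by simp [trunc, hi]⟩
theorem Agr.eq {ℓ : ℕ} {s t : S.Node} (h : Agr ℓ s t) (hs : Nrm ℓ s) (ht : Nrm ℓ t) : s = t := by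
  refine Prod.ext h.1 (funext fun i => ?_)
  by_cases hi : i < ℓ
  · exact h.2 i hi
  · rw [hs i (not_lt.1 hi), ht i (not_lt.1 hi)]
theorem trunc_eq_iff {ℓ : ℕ} {s t : S.Node} : trunc ℓ s = trunc ℓ t ↔ Agr ℓ s t := by
  constructor
  · intro h
    exact (trunc_agr ℓ s).symm.trans (h ▸ trunc_agr ℓ t)
  · intro h
    exact (((trunc_agr ℓ s).trans h).trans (trunc_agr ℓ t).symm).eq (trunc_nrm _ _) (trunc_nrm _ _)
theorem trunc_of_nrm {ℓ : ℕ} {s : S.Node} (h : Nrm ℓ s) : trunc ℓ s = s :=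
  (trunc_agr ℓ s).eq (trunc_nrm _ _) h

theorem finite_nrm (ℓ : ℕ) : Finite {s : S.Node // Nrm ℓ s} := by
  refine Finite.of_injective (fun s : {s : S.Node // Nrm ℓ s} =>
    ((s.1.1, fun i : Fin ℓ => s.1.2 i) : S.υ × (Fin ℓ → S.σ))) ?_
  intro s t h
  have h1 := congrArg Prod.fst h
  have h2 := congrArg Prod.snd h
  exact Subtype.ext (Agr.eq ⟨h1, fun i hi => congrFun h2 ⟨i, hi⟩⟩ s.2 t.2)

theorem OK.congr {W : Type} {q : ℕ → S.Node} {ℓ ℓ' : ℕ} {s s' : W → S.Node} {l : W → W → S.σ}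
    (h : OK q ℓ s l) (hl : ℓ' ≤ ℓ) (hs : ∀ w, Agr ℓ' (s w) (s' w)) : OK q ℓ' s' l := by
  refine h.transfer_map id ?_
  rintro (i | w) hx
  · refine ⟨fun j hj => (hx j hj).trans_le hl, rfl, ?_⟩
    rintro (j | w) hy
    · rfl
    · exact ((hs w).2 i (hx i rfl)).symm
  · refine ⟨fun j hj => (hx j hj).trans_le hl, (hs w).1.symm, ?_⟩
    rintro (j | w') hy
    · change S.sw _ = S.sw _
      rw [(hs w).2 j (hy j rfl)]
    · rfl

theorem OK.reindex {W W' : Type} {q : ℕ → S.Node} {ℓ : ℕ} {s : W → S.Node} {l : W → W → S.σ}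
    (h : OK q ℓ s l) (u : W' → W) : OK q ℓ (fun x => s (u x)) (fun x y => l (u x) (u y)) := by
  refine h.transfer_map (Sum.map id u) ?_
  rintro (i | w) hx
  · refine ⟨fun j hj => hx j (by simpa using hj), rfl, ?_⟩
    rintro (j | w) hy <;> rfl
  · refine ⟨fun j hj => by simp at hj, rfl, ?_⟩
    rintro (j | w) hy <;> rfl

/-- adding the node of level `ℓ` as an extra vertex -/
def optS {W : Type} (t : S.Node) (s : W → S.Node) : Option W → S.Node
  | none => t
  | some w => s w

/-- labels after adding an extra vertex -/
def optL {W : Type} (a : W → S.σ) (l : W → W → S.σ) : Option W → Option W → S.σ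
  | none, none => S.zero
  | none, some w => a w
  | some w, none => S.sw (a w)
  | some w, some w' => l w w'

theorem OK_code {W : Type} {q : ℕ → S.Node} {ℓ : ℕ} {s : W → S.Node} {l : W → W → S.σ} :
    OK q (ℓ + 1) s l ↔ OK q ℓ (optS (q ℓ) s) (optL (fun w => (s w).2 ℓ) l) := by
  constructor
  · intro h
    refine h.transfer_map (fun x => match x with
      | Sum.inl i => Sum.inl i
      | Sum.inr none => Sum.inl ℓ
      | Sum.inr (some w) => Sum.inr w) ?_
    rintro (i | _ | w) hx
    · have hi := hx i rfl
      refine ⟨fun j hj => by simp at hj; omega, rfl, ?_⟩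
      rintro (j | _ | w) hy
      · rfl
      · simp [lab, optS, hi]
      · rfl
    · refine ⟨fun j hj => by simp at hj; omega, rfl, ?_⟩
      rintro (j | _ | w) hy
      · have hj := hy j rfl
        simp [lab, optS, hj, hj.le]
      · simp [lab, optL]
      · rfl
    · refine ⟨fun j hj => by simp at hj, rfl, ?_⟩
      rintro (j | _ | w) hy
      · rfl
      · rfl
      · rfl
  · intro h
    refine h.transfer_map (fun x => match x with
      | Sum.inl i => if i = ℓ then Sum.inr none else Sum.inl i
      | Sum.inr w => Sum.inr (some w)) ?_
    rintro (i | w) hx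
    · have hi := hx i rfl
      by_cases hiℓ : i = ℓ
      · subst hiℓ
        refine ⟨fun j hj => by simp at hj, by simp [un, optS], ?_⟩
        rintro (j | w) hy
        · have hj := hy j rfl
          by_cases hji : j = i
          · subst hji; simp [lab, optL]
          · have : j < i := by omega
            simp [lab, optS, this, this.le, hji]
        · simp [lab, optL]
      · have hi' : i < ℓ := by omega
        refine ⟨fun j hj => by simp [hiℓ] at hj; omega, by simp [un, hiℓ], ?_⟩
        rintro (j | w) hy
        · have hj := hy j rfl
          by_cases hji : j = ℓ
          · subst hji; simp [lab, optS, hi', hiℓ]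
          · simp [lab, hji, hiℓ]
        · simp [lab, optS, hiℓ]
    · refine ⟨fun j hj => by simp at hj, rfl, ?_⟩
      rintro (j | w') hy
      · by_cases hji : j = ℓ
        · subst hji; simp [lab, optL]
        · simp [lab, optS, hji]
      · rfl

/-- single node version -/
def OKp (q : ℕ → S.Node) (ℓ : ℕ) (t : S.Node) : Prop :=
  OK q ℓ (fun _ : Unit => t) (fun _ _ => S.zero)

/-- no bad cliques among levels -/
def Free (q : ℕ → S.Node) : Prop := ∀ ℓ, OK q ℓ (fun x : Empty => x.elim) (fun x _ => x.elim)

theorem Free.ok {q : ℕ → S.Node} (h : Free q) {W : Type} [IsEmpty W] (ℓ : ℕ) (s : W → S.Node)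
    (l : W → W → S.σ) : OK q ℓ s l := by
  have := (h ℓ).reindex (fun w : W => isEmptyElim w)
  convert this using 1

theorem free_of_OKp {q : ℕ → S.Node} (h : ∀ j, OKp q j (q j)) : Free q := by
  have h1 : ∀ ℓ, OK q (ℓ + 1) (fun x : Empty => x.elim) (fun x _ => x.elim) := by
    intro ℓ
    rw [OK_code]
    have := (h ℓ).reindex (fun _ : Option Empty => ())
    convert this using 1
    · funext x; rcases x with _ | x
      · rfl
      · exact x.elim
    · funext x y
      rcases x with _ | x
      · rcases y with _ | y
        · rfl
        · exact y.elim
      · exact x.elim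
  intro ℓ
  exact (h1 ℓ).congr (Nat.le_succ _) (fun x => x.elim)

/-- neutral extension on a set of indices -/
structure Ext {I : Type} (q : ℕ → S.Node) (ℓ ℓ' : ℕ) (T : Set I) (t t' : I → S.Node) : Prop where
  le : ℓ ≤ ℓ'
  agr : ∀ i ∈ T, Agr ℓ (t' i) (t i)
  ok : ∀ (W : Type) [Finite W] (w : W → I) (l : W → W → S.σ), (∀ x, w x ∈ T) →
    OK q ℓ (fun x => t (w x)) l → OK q ℓ' (fun x => t' (w x)) l

theorem Ext.refl {I : Type} (q : ℕ → S.Node) (ℓ : ℕ) (T : Set I) (t : I → S.Node) : Ext q ℓ ℓ T t t :=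
  ⟨le_rfl, fun _ _ => Agr.refl _ _, fun _ _ _ _ _ h => h⟩

theorem Ext.trans {I : Type} {q : ℕ → S.Node} {ℓ ℓ' ℓ'' : ℕ} {T : Set I} {t t' t'' : I → S.Node}
    (h : Ext q ℓ ℓ' T t t') (h' : Ext q ℓ' ℓ'' T t' t'') : Ext q ℓ ℓ'' T t t'' :=
  ⟨h.le.trans h'.le, fun i hi => ((h'.agr i hi).mono h.le).trans (h.agr i hi),
    fun W _ w l hw h0 => h'.ok W w l hw (h.ok W w l hw h0)⟩

theorem Ext.mono {I : Type} {q : ℕ → S.Node} {ℓ ℓ' : ℕ} {T T' : Set I} {t t' : I → S.Node}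
    (h : Ext q ℓ ℓ' T t t') (hT : T' ⊆ T) : Ext q ℓ ℓ' T' t t' :=
  ⟨h.le, fun i hi => h.agr i (hT hi), fun W _ w l hw h0 => h.ok W w l (fun x => hT (hw x)) h0⟩

theorem Ext.congr {I : Type} {q : ℕ → S.Node} {ℓ ℓ' : ℕ} {T : Set I} {t t' s s' : I → S.Node}
    (h : Ext q ℓ ℓ' T t t') (h1 : ∀ i ∈ T, Agr ℓ (s i) (t i)) (h2 : ∀ i ∈ T, Agr ℓ' (s' i) (t' i)) :
    Ext q ℓ ℓ' T s s' :=
  ⟨h.le, fun i hi => (((h2 i hi).mono h.le).trans (h.agr i hi)).trans (h1 i hi).symm,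
    fun W _ w l hw h0 => (h.ok W w l hw (h0.congr le_rfl fun x => h1 _ (hw x))).congr le_rfl
      fun x => (h2 _ (hw x)).symm⟩

theorem Ext.reindex {I I' : Type} {q : ℕ → S.Node} {ℓ ℓ' : ℕ} {T : Set I} {t t' : I → S.Node}
    (h : Ext q ℓ ℓ' T t t') (u : I' → I) (T' : Set I') (hT : ∀ x ∈ T', u x ∈ T) :
    Ext q ℓ ℓ' T' (fun x => t (u x)) (fun x => t' (u x)) :=
  ⟨h.le, fun i hi => h.agr _ (hT i hi), fun W _ w l hw h0 => h.ok W (fun x => u (w x)) l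
    (fun x => hT _ (hw x)) h0⟩

theorem Ext.okp {I : Type} {q : ℕ → S.Node} {ℓ ℓ' : ℕ} {T : Set I} {t t' : I → S.Node}
    (h : Ext q ℓ ℓ' T t t') {i : I} (hi : i ∈ T) (h0 : OKp q ℓ (t i)) : OKp q ℓ' (t' i) :=
  h.ok Unit (fun _ => i) _ (fun _ => hi) h0

/-- zero extension outside of `T` is neutral -/
theorem Ext.nz {I : Type} {q : ℕ → S.Node} {ℓ ℓ' : ℕ} {T T' : Set I} {t t' : I → S.Node}
    (h : Ext q ℓ ℓ' T t t') (h1 : ∀ i ∈ T', Agr ℓ (t' i) (t i))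
    (h2 : ∀ i ∈ T', i ∉ T → ∀ k, ℓ ≤ k → k < ℓ' → (t' i).2 k = S.zero) :
    Ext q ℓ ℓ' T' t t' := by
  classical
  refine ⟨h.le, h1, fun W _ w l hw h0 => ?_⟩
  intro n f f1 f2 f3
  by_cases hex : ∃ a i, f a = Sum.inl i ∧ ℓ ≤ i
  · obtain ⟨a, i, hai, hi⟩ := hex
    have hiℓ := f1 a i hai
    have hT : ∀ b x, f b = Sum.inr x → w x ∈ T := by
      intro b x hb
      by_contra hcon
      have hab : a ≠ b := by
        rintro rfl
        rw [hai] at hb; cases hb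
      refine f2 a b hab ?_
      rw [hai, hb]
      exact h2 _ (hw x) hcon i hi hiℓ
    let W0 := {x : W // w x ∈ T}
    have hk := h.ok W0 (fun x => w x.1) (fun x y => l x.1 y.1) (fun x => x.2)
      (h0.reindex (fun x : W0 => x.1))
    have hf : ∀ b, ∃ y : ℕ ⊕ W0, f b = Sum.map id (fun x : W0 => x.1) y := by
      intro b
      rcases hb : f b with i | x
      · exact ⟨Sum.inl i, rfl⟩
      · exact ⟨Sum.inr ⟨x, hT b x hb⟩, rfl⟩
    choose g hg using hf
    have hlab : ∀ a b, lab q (fun x => t' (w x)) l (f a) (f b) =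
        lab q (fun x : W0 => t' (w x.1)) (fun x y => l x.1 y.1) (g a) (g b) := by
      intro a b
      rw [hg a, hg b]
      rcases g a with i | x <;> rcases g b with j | y <;> rfl
    have hun : ∀ a, un q (fun x => t' (w x)) (f a) = un q (fun x : W0 => t' (w x.1)) (g a) := by
      intro a
      rw [hg a]
      rcases g a with i | x <;> rfl
    refine hk n g ?_ ?_ ?_
    · intro b j hb
      exact f1 b j (by rw [hg b, hb]; rfl)
    · intro b c hbc
      rw [← hlab]; exact f2 b c hbc
    · simp only [hlab, hun] at f3; exact f3
  · push Not at hex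
    have : OK q ℓ (fun x => t' (w x)) l := h0.congr le_rfl (fun x => (h1 _ (hw x)).symm)
    exact this n f (fun a i hai => hex a i hai) f2 f3

theorem Free.ext_empty {I : Type} {q : ℕ → S.Node} (h : Free q) {ℓ ℓ' : ℕ} (hl : ℓ ≤ ℓ')
    (t t' : I → S.Node) : Ext q ℓ ℓ' ∅ t t' :=
  ⟨hl, fun i hi => hi.elim, fun W _ w l hw _ => by
    have : IsEmpty W := ⟨fun x => hw x⟩
    exact h.ok _ _ _⟩

theorem Free.ext_zero {I : Type} {q : ℕ → S.Node} (h : Free q) {ℓ ℓ' : ℕ} (hl : ℓ ≤ ℓ') (T : Set I)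
    (t : I → S.Node) (ht : ∀ i ∈ T, Nrm ℓ (t i)) : Ext q ℓ ℓ' T t t :=
  (h.ext_empty hl t t).nz (fun _ _ => Agr.refl _ _) (fun i hi _ k hk _ => ht i hi k hk)

/-- generic sequences -/
structure Gen (q : ℕ → S.Node) : Prop where
  nrm : ∀ j, Nrm j (q j)
  okp : ∀ j, OKp q j (q j)
  gen : ∀ ℓ t, Nrm ℓ t → OKp q ℓ t → ∃ j, ℓ ≤ j ∧ q j = t

theorem Gen.free {q : ℕ → S.Node} (h : Gen q) : Free q := free_of_OKp h.okp

/-- strong embeddings of (an initial segment of) one sequence into another -/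
structure SEmb (D : Set ℕ) (P q : ℕ → S.Node) (g : ℕ → ℕ) : Prop where
  mono : ∀ i ∈ D, ∀ j ∈ D, i < j → g i < g j
  un : ∀ i ∈ D, (q (g i)).1 = (P i).1
  lab : ∀ i ∈ D, ∀ j ∈ D, i < j → (q (g j)).2 (g i) = (P j).2 i
  agr : ∀ k ∈ D, ∀ i ∈ D, ∀ j ∈ D, k ≤ i → k ≤ j → Agr k (P i) (P j) → Agr (g k) (q (g i)) (q (g j))
  ok : ∀ k ∈ D, ∀ (W : Type) [Finite W] (w : W → ℕ), (∀ x, w x ∈ D ∧ k ≤ w x) → ∀ l : W → W → S.σ,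
    OK P k (fun x => P (w x)) l → OK q (g k) (fun x => q (g (w x))) l

theorem SEmb.le {D : Set ℕ} {P q : ℕ → S.Node} {g : ℕ → ℕ} (h : SEmb D P q g) {i j : ℕ} (hi : i ∈ D)
    (hj : j ∈ D) (hij : i ≤ j) : g i ≤ g j := by
  rcases hij.eq_or_lt with rfl | h'
  · exact le_rfl
  · exact (h.mono i hi j hj h').le

theorem SEmb.comp {D : Set ℕ} {P q : ℕ → S.Node} {g F : ℕ → ℕ} (h : SEmb D P q g)
    (hF : SEmb Set.univ q q F) : SEmb D P q (fun i => F (g i)) where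
  mono i hi j hj hij := hF.mono _ trivial _ trivial (h.mono i hi j hj hij)
  un i hi := (hF.un _ trivial).trans (h.un i hi)
  lab i hi j hj hij := (hF.lab _ trivial _ trivial (h.mono i hi j hj hij)).trans (h.lab i hi j hj hij)
  agr k hk i hi j hj hki hkj ha := hF.agr _ trivial _ trivial _ trivial (h.le hk hi hki) (h.le hk hj hkj)
    (h.agr k hk i hi j hj hki hkj ha)
  ok k hk W _ w hw l h0 := hF.ok _ trivial W (fun x => g (w x))
    (fun x => ⟨trivial, h.le hk (hw x).1 (hw x).2⟩) l (h.ok k hk W w hw l h0)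

theorem SEmb.id (D : Set ℕ) (q : ℕ → S.Node) : SEmb D q q (fun i => i) where
  mono _ _ _ _ h := h
  un _ _ := rfl
  lab _ _ _ _ _ := rfl
  agr _ _ _ _ _ _ _ _ h := h
  ok _ _ _ _ _ _ _ h := h

/-- OK-ness is inherited by embedded pieces. -/
theorem SEmb.ok_back {D : Set ℕ} {P q : ℕ → S.Node} {g : ℕ → ℕ} (h : SEmb D P q g) {k m : ℕ}
    (hk : ∀ i < k, i ∈ D ∧ g i < m) {W : Type} (w : W → ℕ) (hw : ∀ x, w x ∈ D ∧ k ≤ w x)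
    {l : W → W → S.σ} (h0 : OK q m (fun x => q (g (w x))) l) : OK P k (fun x => P (w x)) l := by
  refine h0.transfer_map (Sum.map g _root_.id) ?_
  rintro (i | x) hx
  · have hi := hx i rfl
    refine ⟨fun j hj => ?_, (h.un i (hk i hi).1).symm, ?_⟩
    · simp at hj; subst hj; exact (hk i hi).2
    rintro (j | y) hy
    · have hj := hy j rfl
      rcases lt_trichotomy i j with hij | rfl | hij
      · have := h.mono i (hk i hi).1 j (hk j hj).1 hij
        simp [BRSys.lab, hij, this, h.lab i (hk i hi).1 j (hk j hj).1 hij]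
      · simp [BRSys.lab]
      · have := h.mono j (hk j hj).1 i (hk i hi).1 hij
        simp [BRSys.lab, hij, this, not_lt.2 hij.le, not_lt.2 this.le,
          h.lab j (hk j hj).1 i (hk i hi).1 hij]
    · exact (h.lab i (hk i hi).1 (w y) (hw y).1 (hi.trans_le (hw y).2)).symm
  · refine ⟨fun j hj => by simp at hj, (h.un _ (hw x).1).symm, ?_⟩
    rintro (j | y) hy
    · have hj := hy j rfl
      exact congrArg S.sw (h.lab j (hk j hj).1 (w x) (hw x).1 (hj.trans_le (hw x).2)).symm
    · rfl

end BRSys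

end Part2

section Part3

namespace BRSys

variable {S : BRSys}

/-- finite conditions -/
structure Cond (S : BRSys) (J : Type) where
  lev : ℕ
  dom : Finset J
  val : J → S.Node
  nrm : ∀ i ∈ dom, Nrm lev (val i)

/-- order on conditions -/
structure Cond.Le {J : Type} (Ω : ℕ → S.Node) (q p : Cond S J) : Prop where
  sub : p.dom ⊆ q.dom
  ext : Ext Ω p.lev q.lev (p.dom : Set J) p.val q.val

theorem Cond.Le.trans {J : Type} {Ω : ℕ → S.Node} {r q p : Cond S J} (h : Cond.Le Ω r q)
    (h' : Cond.Le Ω q p) : Cond.Le Ω r p :=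
  ⟨h'.sub.trans h.sub, h'.ext.trans (h.ext.mono (by exact_mod_cast h'.sub))⟩

theorem Cond.Le.refl {J : Type} (Ω : ℕ → S.Node) (p : Cond S J) : Cond.Le Ω p p :=
  ⟨fun _ h => h, Ext.refl _ _ _ _⟩

/-- consistent sets of promises -/
structure Cons (Ω : ℕ → S.Node) {C : Type} (X : C → Type) (κ0 : C) {Γ : Type}
    (ψ : ℕ → (C → S.Node) → Γ) (Z : Set (Cond S (Sigma X) × (∀ κ, X κ) × Γ)) : Prop where
  down : ∀ p q α ε, (p, α, ε) ∈ Z → Cond.Le Ω q p → (q, α, ε) ∈ Z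
  cons : ∀ (p : Cond S (Sigma X)) (x : X κ0), ⟨κ0, x⟩ ∈ p.dom → OKp Ω p.lev (p.val ⟨κ0, x⟩) →
    ∀ A : Finset ((∀ κ, X κ) × Γ), (∀ a ∈ A, (p, a.1, a.2) ∈ Z ∧ a.1 κ0 = x) →
    ∃ q : Cond S (Sigma X), Cond.Le Ω q p ∧ Ω q.lev = q.val ⟨κ0, x⟩ ∧
      ∀ a ∈ A, ψ q.lev (fun κ => q.val ⟨κ, a.1 κ⟩) = a.2

theorem exists_max_cons {Ω : ℕ → S.Node} (hΩ : Gen Ω) {C : Type} (X : C → Type) (κ0 : C) {Γ : Type}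
    (ψ : ℕ → (C → S.Node) → Γ) : ∃ Z, Maximal (Cons Ω X κ0 ψ) Z := by
  classical
  have hempty : Cons Ω X κ0 ψ ∅ := by
    refine ⟨fun p q α ε h => h.elim, fun p x hx hok A hA => ?_⟩
    obtain ⟨j, hj, hjq⟩ := hΩ.gen p.lev _ (p.nrm _ hx) hok
    refine ⟨⟨j, p.dom, p.val, fun i hi => (p.nrm i hi).mono hj⟩, ⟨fun _ h => h, ?_⟩, hjq, ?_⟩
    · exact hΩ.free.ext_zero hj _ _ (fun i hi => p.nrm i hi)
    · intro a ha
      exact (hA a ha).1.elim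
  obtain ⟨Z, hZ⟩ := zorn_subset {Z | Cons Ω X κ0 ψ Z} (by
    intro c hc hch
    by_cases hne : c.Nonempty
    · refine ⟨⋃₀ c, ⟨?_, ?_⟩, fun s hs => Set.subset_sUnion_of_mem hs⟩
      · rintro p q α ε ⟨Z, hZ, hp⟩ hle
        exact ⟨Z, hZ, (hc hZ).down p q α ε hp hle⟩
      · intro p x hx hok A hA
        have : ∀ A : Finset ((∀ κ, X κ) × Γ), (∀ a ∈ A, (p, a.1, a.2) ∈ ⋃₀ c) →
            ∃ Z ∈ c, ∀ a ∈ A, (p, a.1, a.2) ∈ Z := by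
          intro A
          induction A using Finset.induction_on with
          | empty => intro _; obtain ⟨Z, hZ⟩ := hne; exact ⟨Z, hZ, by simp⟩
          | insert a A ha ih =>
            intro h
            obtain ⟨Z, hZ, h1⟩ := ih (fun b hb => h b (Finset.mem_insert_of_mem hb))
            obtain ⟨Z', hZ', h2⟩ := h a (Finset.mem_insert_self _ _)
            rcases hch.total hZ hZ' with h3 | h3
            · refine ⟨Z', hZ', fun b hb => ?_⟩
              rcases Finset.mem_insert.1 hb with rfl | hb
              · exact h2
              · exact h3 (h1 b hb)
            · refine ⟨Z, hZ, fun b hb => ?_⟩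
              rcases Finset.mem_insert.1 hb with rfl | hb
              · exact h3 h2
              · exact h1 b hb
        obtain ⟨Z, hZ, h1⟩ := this A (fun a ha => (hA a ha).1)
        exact (hc hZ).cons p x hx hok A (fun a ha => ⟨h1 a ha, (hA a ha).2⟩)
    · refine ⟨∅, hempty, fun s hs => (hne ⟨s, hs⟩).elim⟩)
  exact ⟨Z, hZ⟩

theorem cons_dense {Ω : ℕ → S.Node} {C : Type} {X : C → Type} {κ0 : C} {Γ : Type}
    [Finite Γ] {ψ : ℕ → (C → S.Node) → Γ} {Z : Set (Cond S (Sigma X) × (∀ κ, X κ) × Γ)}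
    (hZ : Maximal (Cons Ω X κ0 ψ) Z) (p0 : Cond S (Sigma X)) (α : ∀ κ, X κ)
    (h0 : ⟨κ0, α κ0⟩ ∈ p0.dom) (hok : OKp Ω p0.lev (p0.val ⟨κ0, α κ0⟩)) :
    ∃ p ε, Cond.Le Ω p p0 ∧ (p, α, ε) ∈ Z := by
  classical
  by_contra hcon
  push Not at hcon
  have step : ∀ (p : Cond S (Sigma X)), Cond.Le Ω p p0 → ∀ ε, ∃ q, Cond.Le Ω q p ∧
      OKp Ω q.lev (q.val ⟨κ0, α κ0⟩) ∧ ∃ A : Finset ((∀ κ, X κ) × Γ),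
      (∀ a ∈ A, (q, a.1, a.2) ∈ Z ∧ a.1 κ0 = α κ0) ∧ ∀ q' : Cond S (Sigma X), Cond.Le Ω q' q →
        Ω q'.lev = q'.val ⟨κ0, α κ0⟩ → (∀ a ∈ A, ψ q'.lev (fun κ => q'.val ⟨κ, a.1 κ⟩) = a.2) →
        ψ q'.lev (fun κ => q'.val ⟨κ, α κ⟩) ≠ ε := by
    intro p hp ε
    let Z' : Set (Cond S (Sigma X) × (∀ κ, X κ) × Γ) :=
      Z ∪ {y | Cond.Le Ω y.1 p ∧ y.2.1 = α ∧ y.2.2 = ε}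
    have hnot : ¬ Cons Ω X κ0 ψ Z' := by
      intro hZ'
      have := hZ.2 hZ' (Set.subset_union_left)
      exact hcon p ε hp (this (Or.inr ⟨Cond.Le.refl _ _, rfl, rfl⟩))
    by_contra hno
    push Not at hno
    apply hnot
    refine ⟨?_, ?_⟩
    · rintro q r β δ (h | ⟨h1, h2, h3⟩) hle
      · exact Or.inl (hZ.1.down _ _ _ _ h hle)
      · exact Or.inr ⟨hle.trans h1, h2, h3⟩
    · intro q x hx hqok A hA
      by_cases hcase : Cond.Le Ω q p ∧ x = α κ0
      · obtain ⟨hqp, rfl⟩ := hcase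
        obtain ⟨q', hq', h1, h2, h3⟩ := hno q hqp hqok (A.filter (fun a => (q, a.1, a.2) ∈ Z)) (by
          intro a ha
          rw [Finset.mem_filter] at ha
          exact ⟨ha.2, (hA a ha.1).2⟩)
        refine ⟨q', hq', h1, fun a ha => ?_⟩
        rcases (hA a ha).1 with h | ⟨_, h5, h6⟩
        · exact h2 a (Finset.mem_filter.2 ⟨ha, h⟩)
        · simp only at h5 h6
          rw [h5, h6]; exact h3
      · refine hZ.1.cons q x hx hqok A (fun a ha => ⟨?_, (hA a ha).2⟩)
        rcases (hA a ha).1 with h | ⟨h4, h5, h6⟩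
        · exact h
        · simp only at h5
          exact (hcase ⟨h4, by rw [← (hA a ha).2, h5]⟩).elim
  have main : ∀ T : Finset Γ, ∃ q, Cond.Le Ω q p0 ∧
      OKp Ω q.lev (q.val ⟨κ0, α κ0⟩) ∧ ∃ A : Finset ((∀ κ, X κ) × Γ),
      (∀ a ∈ A, (q, a.1, a.2) ∈ Z ∧ a.1 κ0 = α κ0) ∧ ∀ q' : Cond S (Sigma X), Cond.Le Ω q' q →
        Ω q'.lev = q'.val ⟨κ0, α κ0⟩ → (∀ a ∈ A, ψ q'.lev (fun κ => q'.val ⟨κ, a.1 κ⟩) = a.2) →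
        ψ q'.lev (fun κ => q'.val ⟨κ, α κ⟩) ∉ T := by
    intro T
    induction T using Finset.induction_on with
    | empty => exact ⟨p0, Cond.Le.refl _ _, hok, ∅, by simp, by simp⟩
    | insert ε T _ ih =>
      obtain ⟨q, hq, _, A, hA, h1⟩ := ih
      obtain ⟨q2, hq2, hok2, A2, hA2, h2⟩ := step q hq ε
      refine ⟨q2, hq2.trans hq, hok2, A ∪ A2, ?_, ?_⟩
      · intro a ha
        rcases Finset.mem_union.1 ha with h | h
        · exact ⟨hZ.1.down _ _ _ _ (hA a h).1 hq2, (hA a h).2⟩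
        · exact hA2 a h
      · intro q' hq' h3 h4 h5
        rcases Finset.mem_insert.1 h5 with h | h
        · exact h2 q' hq' h3 (fun a ha => h4 a (Finset.mem_union_right _ ha)) h
        · exact h1 q' (hq'.trans hq2) h3 (fun a ha => h4 a (Finset.mem_union_left _ ha)) h
  have := Fintype.ofFinite Γ
  obtain ⟨q, hq, hqok, A, hA, h1⟩ := main Finset.univ
  obtain ⟨q', hq', h2, h3⟩ := hZ.1.cons q (α κ0) (hq.sub h0) hqok A hA
  exact h1 q' hq' h2 h3 (Finset.mem_univ _)

open Cardinal in
theorem mk_node_le : #(S.Node) ≤ 2 ^ ℵ₀ := by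
  have h1 : #S.υ ≤ 2 ^ ℵ₀ := (Cardinal.lt_aleph0_of_finite _).le.trans (Cardinal.cantor _).le
  have h2 : #(ℕ → S.σ) ≤ 2 ^ ℵ₀ := by
    rw [← Cardinal.power_def, Cardinal.mk_nat]
    calc #S.σ ^ ℵ₀ ≤ (2 ^ ℵ₀) ^ ℵ₀ :=
          Cardinal.power_le_power_right ((Cardinal.lt_aleph0_of_finite _).le.trans (Cardinal.cantor _).le)
      _ = 2 ^ ℵ₀ := by rw [← Cardinal.power_mul, Cardinal.mul_eq_self le_rfl]
  rw [Cardinal.mk_prod, Cardinal.lift_id, Cardinal.lift_id]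
  calc #S.υ * #(ℕ → S.σ) ≤ 2 ^ ℵ₀ * 2 ^ ℵ₀ := by gcongr
    _ = 2 ^ ℵ₀ := Cardinal.mul_eq_self (Cardinal.cantor _).le

/-- The dense lemma. -/
theorem dense_lemma {Ω : ℕ → S.Node} (hΩ : Gen Ω) (C : Type) [Finite C] (κ0 : C) (m : ℕ)
    (h : C → S.Node) (hh : ∀ κ, Nrm m (h κ)) (hok : OKp Ω m (h κ0)) (Γ : Type) [Finite Γ]
    (ψ : ℕ → (C → S.Node) → Γ) :
    ∃ (L0 : ℕ) (e0 : C → S.Node) (ε : Γ), (∀ κ, Nrm L0 (e0 κ)) ∧ Ext Ω m L0 Set.univ h e0 ∧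
      ∀ (B : Type) [Finite B] (π : B → C) (L : ℕ) (R : B → S.Node), L0 ≤ L → (∀ b, Nrm L (R b)) →
        (∀ b, Agr L0 (R b) (e0 (π b))) → ∀ v, π v = κ0 → OKp Ω L (R v) →
        ∃ (ℓ : ℕ) (R' : B → S.Node), Ext Ω L ℓ Set.univ R R' ∧ (∀ b, Nrm ℓ (R' b)) ∧ Ω ℓ = R' v ∧
          ∀ s : C → B, (∀ κ, π (s κ) = κ) → s κ0 = v →
            Ext Ω L0 L Set.univ e0 (fun κ => R (s κ)) → ψ ℓ (fun κ => R' (s κ)) = ε := by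
  classical
  obtain ⟨X, hX, hpol⟩ := BR_polar C
  have := Fintype.ofFinite C
  have hXne : ∀ c, Nonempty (X c) := fun c => inferInstance
  obtain ⟨Z, hZ⟩ := exists_max_cons hΩ X κ0 ψ
  let gr : (∀ κ, X κ) → Finset (Sigma X) := fun α => Finset.univ.image (fun κ => ⟨κ, α κ⟩)
  have hgr : ∀ α κ, (⟨κ, α κ⟩ : Sigma X) ∈ gr α := fun α κ =>
    Finset.mem_image.2 ⟨κ, Finset.mem_univ _, rfl⟩
  have hgr' : ∀ α i, i ∈ gr α → α i.1 = i.2 := by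
    intro α i hi
    obtain ⟨κ, _, rfl⟩ := Finset.mem_image.1 hi
    rfl
  let base : (∀ κ, X κ) → Cond S (Sigma X) := fun α => ⟨m, gr α, fun i => h i.1, fun i _ => hh _⟩
  have hd : ∀ α, ∃ p ε, Cond.Le Ω p (base α) ∧ (p, α, ε) ∈ Z := fun α =>
    cons_dense hZ (base α) α (hgr α κ0) hok
  choose p ε hp hpZ using hd
  have hdom : ∀ α κ, (⟨κ, α κ⟩ : Sigma X) ∈ (p α).dom := fun α κ => (hp α).sub (hgr α κ)
  let V := (ℕ × Γ × (C → S.Node)) ⊕ (S.Node × Prop)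
  have hV : Cardinal.mk V ≤ 2 ^ Cardinal.aleph0 := by
    have hc1 := (Cardinal.cantor Cardinal.aleph0).le
    have hmul : ∀ c d : Cardinal, c ≤ 2 ^ Cardinal.aleph0 → d ≤ 2 ^ Cardinal.aleph0 →
        c * d ≤ 2 ^ Cardinal.aleph0 := by
      intro c d hc hd
      calc c * d ≤ 2 ^ Cardinal.aleph0 * 2 ^ Cardinal.aleph0 := by gcongr
        _ = _ := Cardinal.mul_eq_self hc1
    have hΓ : Cardinal.mk Γ ≤ 2 ^ Cardinal.aleph0 := (Cardinal.lt_aleph0_of_finite _).le.trans hc1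
    have hPr : Cardinal.mk Prop ≤ 2 ^ Cardinal.aleph0 := (Cardinal.lt_aleph0_of_finite _).le.trans hc1
    have hCN : Cardinal.mk (C → S.Node) ≤ 2 ^ Cardinal.aleph0 := by
      rw [← Cardinal.power_def]
      calc Cardinal.mk S.Node ^ Cardinal.mk C ≤ (2 ^ Cardinal.aleph0) ^ Cardinal.mk C :=
            Cardinal.power_le_power_right mk_node_le
        _ = 2 ^ (Cardinal.aleph0 * Cardinal.mk C) := by rw [← Cardinal.power_mul]
        _ ≤ _ := Cardinal.power_le_power_left two_ne_zero
            (Cardinal.mul_le_of_le le_rfl le_rfl (Cardinal.lt_aleph0_of_finite _).le)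
    simp only [V, Cardinal.mk_sum, Cardinal.lift_id]
    refine Cardinal.add_le_of_le hc1 ?_ ?_
    · rw [Cardinal.mk_prod, Cardinal.lift_id, Cardinal.lift_id, Cardinal.mk_prod, Cardinal.lift_id,
        Cardinal.lift_id]
      exact hmul _ _ (by rw [Cardinal.mk_nat]; exact hc1) (hmul _ _ hΓ hCN)
    · rw [Cardinal.mk_prod, Cardinal.lift_id, Cardinal.lift_id]
      exact hmul _ _ mk_node_le hPr
  let ph : (∀ κ, X κ) → Option (Sigma X) → Option V := fun α o => match o with
    | none => some (Sum.inl ((p α).lev, ε α, fun κ => (p α).val ⟨κ, α κ⟩))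
    | some i => if i ∈ (p α).dom then some (Sum.inr ((p α).val i, i ∈ gr α)) else none
  obtain ⟨H, hH, hcomp⟩ := hpol (Option (Sigma X)) V ⟨none⟩ hV ph (by
    intro α
    refine Set.Finite.countable (((p α).dom.image some ∪ {none}).finite_toSet.subset ?_)
    rintro (_ | i) hi
    · simp
    · by_cases hi' : i ∈ (p α).dom
      · simp [hi']
      · simp [ph, hi'] at hi)
  have hne : ∀ c, (H c).Nonempty := fun c => (hH c).nonempty
  choose a0 ha0 using hne
  let L0 := (p a0).lev
  let e0 : C → S.Node := fun κ => (p a0).val ⟨κ, a0 κ⟩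
  have hc0 : ∀ α, (∀ c, α c ∈ H c) → (p α).lev = L0 ∧ ε α = ε a0 ∧ ∀ κ, (p α).val ⟨κ, α κ⟩ = e0 κ := by
    intro α hα
    have h1 := Sum.inl.inj (hcomp α a0 hα ha0 none _ _ rfl rfl)
    simp only [Prod.mk.injEq] at h1
    exact ⟨h1.1, h1.2.1, fun κ => congrFun h1.2.2 κ⟩
  have hc1 : ∀ α β, (∀ c, α c ∈ H c) → (∀ c, β c ∈ H c) → ∀ i ∈ (p α).dom, i ∈ (p β).dom →
      (p α).val i = (p β).val i ∧ (i ∈ gr α ↔ i ∈ gr β) := by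
    intro α β hα hβ i hi hi'
    have h1 := Sum.inr.inj (hcomp α β hα hβ (some i) _ _ (if_pos hi) (if_pos hi'))
    simp only [Prod.mk.injEq] at h1
    exact ⟨h1.1, by rw [h1.2]⟩
  refine ⟨L0, e0, ε a0, fun κ => (p a0).nrm _ (hdom a0 κ), ?_, ?_⟩
  · exact (hp a0).ext.reindex (fun κ => (⟨κ, a0 κ⟩ : Sigma X)) _ (fun κ _ => hgr a0 κ)
  intro B _ π L R hL hR hRe v hv hokv
  have := Fintype.ofFinite B
  have hemb : ∀ κ, ∃ f : B → X κ, Function.Injective f ∧ ∀ b, f b ∈ H κ := by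
    intro κ
    have := (hH κ).to_subtype
    obtain ⟨f⟩ : Nonempty (B ↪ H κ) := by
      exact ⟨((Fintype.equivFin B).toEmbedding.trans Fin.valEmbedding).trans (hH κ).natEmbedding⟩
    exact ⟨fun b => (f b).1, fun a b hab => f.injective (Subtype.ext hab), fun b => (f b).2⟩
  choose emb embinj embH using hemb
  let idx : B → Sigma X := fun b => ⟨π b, emb (π b) b⟩
  have hidx : ∀ κ b, π b = κ → idx b = ⟨κ, emb κ b⟩ := by rintro _ b rfl; rfl
  have idxinj : Function.Injective idx := by
    intro a b hab
    have h1 : π a = π b := congrArg Sigma.fst hab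
    rw [hidx (π b) a h1, hidx (π b) b rfl] at hab
    exact embinj (π b) (by simpa using hab)
  let Sec : Set (C → B) := {s | (∀ κ, π (s κ) = κ) ∧ s κ0 = v ∧ Ext Ω L0 L Set.univ e0 (fun κ => R (s κ))}
  let al : (C → B) → ∀ κ, X κ := fun s κ => emb κ (s κ)
  have hal : ∀ s c, al s c ∈ H c := fun s c => embH c _
  have hmeet : ∀ s ∈ Sec, ∀ b, idx b ∈ (p (al s)).dom → ∃ κ, b = s κ := by
    intro s hs b hb
    let β : ∀ κ, X κ := Function.update (al s) (π b) (emb (π b) b)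
    have hβ : ∀ c, β c ∈ H c := by
      intro c
      by_cases hc : c = π b
      · subst hc; simp only [β, Function.update_self]; exact embH _ _
      · simp only [β, Function.update_of_ne hc]; exact hal s c
    have hβb : idx b = ⟨π b, β (π b)⟩ := by simp [idx, β]
    have h1 : idx b ∈ gr β := by rw [hβb]; exact hgr β _
    have h2 : idx b ∈ (p β).dom := by rw [hβb]; exact hdom β _
    have h3 := hgr' _ _ (((hc1 (al s) β (hal s) hβ _ hb h2).2).2 h1)
    refine ⟨π b, ?_⟩
    exact (embinj (π b) h3).symm
  let val : Sigma X → S.Node := fun i =>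
    if hi : ∃ b, idx b = i then R hi.choose
    else if hi : ∃ s, s ∈ Sec ∧ i ∈ (p (al s)).dom then (p (al hi.choose)).val i else h i.1
  have hval1 : ∀ b, val (idx b) = R b := by
    intro b
    have hi : ∃ b', idx b' = idx b := ⟨b, rfl⟩
    simp only [val, dif_pos hi]
    rw [idxinj hi.choose_spec]
  have hval2 : ∀ i, (¬ ∃ b, idx b = i) → ∀ s ∈ Sec, i ∈ (p (al s)).dom → val i = (p (al s)).val i := by
    intro i hi s hs his
    have hi' : ∃ s, s ∈ Sec ∧ i ∈ (p (al s)).dom := ⟨s, hs, his⟩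
    simp only [val, dif_neg hi, dif_pos hi']
    exact (hc1 _ _ (hal _) (hal _) i hi'.choose_spec.2 his).1
  let dom : Finset (Sigma X) := Finset.univ.image idx ∪
    (Finset.univ.filter (fun s => s ∈ Sec)).biUnion (fun s => (p (al s)).dom)
  let r : Cond S (Sigma X) := ⟨L, dom, val, by
    intro i hi
    by_cases hib : ∃ b, idx b = i
    · obtain ⟨b, rfl⟩ := hib
      rw [hval1]; exact hR b
    · rcases Finset.mem_union.1 hi with hi | hi
      · obtain ⟨b, _, hb⟩ := Finset.mem_image.1 hi
        exact (hib ⟨b, hb⟩).elim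
      · obtain ⟨s, hs, his⟩ := Finset.mem_biUnion.1 hi
        have hs' : s ∈ Sec := (Finset.mem_filter.1 hs).2
        rw [hval2 i hib s hs' his]
        exact ((p (al s)).nrm i his).mono (by rw [(hc0 _ (hal s)).1]; exact hL)⟩
  have hidxs : ∀ s ∈ Sec, ∀ κ, idx (s κ) = ⟨κ, al s κ⟩ := fun s hs κ => hidx κ (s κ) (hs.1 κ)
  have hle : ∀ s ∈ Sec, Cond.Le Ω r (p (al s)) := by
    intro s hs
    refine ⟨?_, ?_⟩
    · intro i hi
      exact Finset.mem_union_right _ (Finset.mem_biUnion.2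
        ⟨s, Finset.mem_filter.2 ⟨Finset.mem_univ _, hs⟩, hi⟩)
    · have hlev := (hc0 _ (hal s)).1
      have hE : Ext Ω L0 L (Set.range (fun κ => (⟨κ, al s κ⟩ : Sigma X))) (p (al s)).val val := by
        have := hs.2.2.reindex (fun i : Sigma X => i.1)
          (Set.range (fun κ => (⟨κ, al s κ⟩ : Sigma X))) (fun _ _ => trivial)
        refine this.congr ?_ ?_
        · rintro _ ⟨κ, rfl⟩
          simp only
          rw [(hc0 _ (hal s)).2.2 κ]
          exact Agr.refl _ _
        · rintro _ ⟨κ, rfl⟩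
          simp only
          rw [← hidxs s hs κ, hval1]
          exact Agr.refl _ _
      rw [hlev]
      refine hE.nz ?_ ?_
      · intro i hi
        by_cases hib : ∃ b, idx b = i
        · obtain ⟨b, rfl⟩ := hib
          obtain ⟨κ, rfl⟩ := hmeet s hs b hi
          rw [hval1, hidxs s hs κ, (hc0 _ (hal s)).2.2 κ]
          have := hRe (s κ)
          rwa [hs.1 κ] at this
        · rw [hval2 i hib s hs hi]
          exact Agr.refl _ _
      · intro i hi hi2 k hk hkL
        by_cases hib : ∃ b, idx b = i
        · obtain ⟨b, rfl⟩ := hib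
          obtain ⟨κ, rfl⟩ := hmeet s hs b hi
          exact (hi2 ⟨κ, (hidxs s hs κ).symm⟩).elim
        · rw [hval2 i hib s hs hi]
          exact (p (al s)).nrm i hi k (by rw [hlev]; exact hk)
  obtain ⟨q, hq, hq1, hq2⟩ := hZ.1.cons r (emb κ0 v)
    (Finset.mem_union_left _ (Finset.mem_image.2 ⟨v, Finset.mem_univ _, hidx κ0 v hv⟩))
    (by
      change OKp Ω L (val _)
      rw [← hidx κ0 v hv, hval1]; exact hokv)
    ((Finset.univ.filter (fun s => s ∈ Sec)).image (fun s => (al s, ε a0))) (by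
      intro a ha
      obtain ⟨s, hs, rfl⟩ := Finset.mem_image.1 ha
      have hs' : s ∈ Sec := (Finset.mem_filter.1 hs).2
      refine ⟨?_, ?_⟩
      · have := hpZ (al s)
        rw [(hc0 _ (hal s)).2.1] at this
        exact hZ.1.down _ _ _ _ this (hle s hs')
      · simp only [al]
        rw [hs'.2.1])
  have hidxdom : ∀ b, idx b ∈ dom := fun b =>
    Finset.mem_union_left _ (Finset.mem_image.2 ⟨b, Finset.mem_univ _, rfl⟩)
  refine ⟨q.lev, fun b => q.val (idx b), ?_, ?_, ?_, ?_⟩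
  · have := hq.ext.reindex idx Set.univ (fun b _ => hidxdom b)
    refine this.congr (fun b _ => ?_) (fun b _ => Agr.refl _ _)
    change Agr L (R b) (val (idx b))
    rw [hval1]; exact Agr.refl _ _
  · intro b
    exact q.nrm _ (hq.sub (hidxdom b))
  · exact hq1.trans (congrArg q.val (hidx κ0 v hv).symm)
  · intro s hs1 hs2 hs3
    have hs : s ∈ Sec := ⟨hs1, hs2, hs3⟩
    have := hq2 (al s, ε a0) (Finset.mem_image.2 ⟨s, Finset.mem_filter.2 ⟨Finset.mem_univ _, hs⟩, rfl⟩)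
    simp only at this
    rw [← this]
    congr 1
    funext κ
    exact congrArg q.val (hidxs s hs κ)

end BRSys

end Part3

section Part4

namespace BRSys

variable {S : BRSys}

theorem Ext.of_subtype {I : Type} {q : ℕ → S.Node} {ℓ ℓ' : ℕ} {T : Set I} {t t' : I → S.Node}
    (h : Ext q ℓ ℓ' (Set.univ : Set T) (fun x => t x.1) (fun x => t' x.1)) : Ext q ℓ ℓ' T t t' :=
  ⟨h.le, fun i hi => h.agr ⟨i, hi⟩ trivial, fun W _ w l hw h0 =>
    h.ok W (fun x => ⟨w x, hw x⟩) l (fun _ => trivial) h0⟩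

/-- states of the recursion -/
structure PSt (S : BRSys) where
  g : ℕ → ℕ
  L : ℕ
  θ : S.Node → S.Node

/-- invariants of the recursion -/
structure PInv (Ω : ℕ → S.Node) {C : Type} (m : ℕ) (h : C → S.Node) (L0 : ℕ) (e0 : C → S.Node)
    (j : ℕ) (st : PSt S) : Prop where
  nrm : ∀ τ, Nrm j τ → Nrm st.L (st.θ τ)
  lt : ∀ i < j, st.g i < st.L
  un : ∀ τ, Nrm j τ → (st.θ τ).1 = τ.1
  lab : ∀ τ, Nrm j τ → ∀ i < j, (st.θ τ).2 (st.g i) = τ.2 i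
  ok : ∀ (W : Type) [Finite W] (w : W → S.Node) (l : W → W → S.σ), (∀ x, Nrm j (w x)) →
    OK Ω j w l → OK Ω st.L (fun x => st.θ (w x)) l
  le : L0 ≤ st.L
  agr : ∀ τ κ, Nrm j τ → Agr m τ (h κ) → Agr L0 (st.θ τ) (e0 κ)

/-- next state -/
def PSt.next (st : PSt S) (j ℓ : ℕ) (R : S.Node → S.Node) : PSt S where
  g := Function.update st.g j ℓ
  L := ℓ + 1
  θ := fun τ => ((R (trunc j τ)).1, Function.update (R (trunc j τ)).2 ℓ (τ.2 j))

theorem PInv.next {Ω : ℕ → S.Node} (hΩ : Gen Ω) {C : Type} {m : ℕ} {h : C → S.Node} {L0 : ℕ}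
    {e0 : C → S.Node} {j : ℕ} (hj : m ≤ j) {st : PSt S} (I : PInv Ω m h L0 e0 j st) {ℓ : ℕ}
    {R : S.Node → S.Node} (hR : Ext Ω st.L ℓ {τ | Nrm j τ} st.θ R) (hR1 : ∀ τ, Nrm j τ → Nrm ℓ (R τ))
    (hR2 : Ω ℓ = R (Ω j)) : PInv Ω m h L0 e0 (j + 1) (st.next j ℓ R) := by
  have hag : ∀ τ, Agr ℓ ((st.next j ℓ R).θ τ) (R (trunc j τ)) := by
    intro τ
    refine ⟨rfl, fun i hi => ?_⟩
    simp [PSt.next, Function.update_of_ne hi.ne]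
  have hag2 : ∀ τ, Agr st.L (R (trunc j τ)) (st.θ (trunc j τ)) := fun τ => hR.agr _ (trunc_nrm j τ)
  have hag3 : ∀ τ, Agr st.L ((st.next j ℓ R).θ τ) (st.θ (trunc j τ)) := fun τ =>
    ((hag τ).mono hR.le).trans (hag2 τ)
  refine ⟨?_, ?_, ?_, ?_, ?_, ?_, ?_⟩
  · intro τ _ i hi
    have hi' : i ≠ ℓ := by simp [PSt.next] at hi; omega
    simp only [PSt.next, Function.update_of_ne hi']
    exact hR1 _ (trunc_nrm _ _) i (by simp [PSt.next] at hi; omega)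
  · intro i hi
    simp only [PSt.next]
    by_cases hij : i = j
    · subst hij; simp
    · rw [Function.update_of_ne hij]
      have := I.lt i (by omega)
      have := hR.le
      omega
  · intro τ hτ
    rw [(hag3 τ).1, I.un _ (trunc_nrm _ _)]; rfl
  · intro τ hτ i hi
    by_cases hij : i = j
    · subst hij; simp [PSt.next]
    · have hi' : i < j := by omega
      have hg : (st.next j ℓ R).g i = st.g i := by simp [PSt.next, hij]
      rw [hg, (hag3 τ).2 _ (I.lt i hi'), I.lab _ (trunc_nrm _ _) i hi', (trunc_agr j τ).2 i hi']
  · intro W _ w l hw h0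
    rw [OK_code] at h0
    have h1 : OK Ω j (fun x => trunc j (optS (Ω j) w x)) (optL (fun x => (w x).2 j) l) :=
      h0.congr le_rfl (fun x => (trunc_agr _ _).symm)
    have h2 := I.ok _ _ _ (fun x => trunc_nrm _ _) h1
    have h3 := hR.ok _ (fun x => trunc j (optS (Ω j) w x)) _ (fun x => trunc_nrm _ _) h2
    change OK Ω (ℓ + 1) _ _
    rw [OK_code]
    have hl : (fun x => ((st.next j ℓ R).θ (w x)).2 ℓ) = (fun x => (w x).2 j) := by
      funext x; simp [PSt.next]
    rw [hl]
    refine h3.congr le_rfl ?_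
    rintro (_ | x)
    · simp only [optS]
      rw [hR2, trunc_of_nrm (hΩ.nrm j)]
      exact Agr.refl _ _
    · exact (hag (w x)).symm
  · have := I.le
    have := hR.le
    simp only [PSt.next]; omega
  · intro τ κ hτ hκ
    exact ((hag3 τ).mono I.le).trans (I.agr _ κ (trunc_nrm _ _) (((trunc_agr j τ).mono hj).trans hκ))

theorem pigeon {Ω : ℕ → S.Node} (hΩ : Gen Ω) (C : Type) [Finite C] (κ0 : C) (m : ℕ)
    (h : C → S.Node) (hh : ∀ κ, Nrm m (h κ)) (hinj : Function.Injective h) (hok : OKp Ω m (h κ0))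
    (Γ : Type) [Finite Γ] (ψ : ℕ → (C → S.Node) → Γ) :
    ∃ G : ℕ → ℕ, SEmb Set.univ Ω Ω G ∧ (∀ i < m, G i = i) ∧ (∀ i, Agr m (Ω (G i)) (Ω i)) ∧
      ∃ ε, ∀ (i : C → ℕ), m ≤ i κ0 → (∀ κ, i κ0 ≤ i κ) → Ext Ω m (i κ0) Set.univ h (fun κ => Ω (i κ)) →
      ψ (G (i κ0)) (fun κ => trunc (G (i κ0)) (Ω (G (i κ)))) = ε := by
  classical
  obtain ⟨L0, e0, ε, he0, hext0, hDL⟩ := dense_lemma hΩ C κ0 m h hh hok Γ ψ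
  -- the step
  have hstep : ∀ j (st : PSt S), m ≤ j → PInv Ω m h L0 e0 j st → ∃ (ℓ : ℕ) (R : S.Node → S.Node),
      Ext Ω st.L ℓ {τ | Nrm j τ} st.θ R ∧ (∀ τ, Nrm j τ → Nrm ℓ (R τ)) ∧ Ω ℓ = R (Ω j) ∧
      ∀ s : C → S.Node, (∀ κ, Nrm j (s κ)) → (∀ κ, Agr m (s κ) (h κ)) → s κ0 = Ω j →
        Ext Ω L0 st.L Set.univ e0 (fun κ => st.θ (s κ)) → ψ ℓ (fun κ => R (s κ)) = ε := by
    intro j st hj I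
    have hokj : OKp Ω st.L (st.θ (Ω j)) := I.ok Unit _ _ (fun _ => hΩ.nrm j) (hΩ.okp j)
    by_cases hc : Agr m (Ω j) (h κ0)
    · let T : Set S.Node := {τ | Nrm j τ ∧ ∃ κ, Agr m τ (h κ)}
      have : Finite T := by
        have := finite_nrm (S := S) j
        exact Finite.of_injective (fun τ : T => (⟨τ.1, τ.2.1⟩ : {s : S.Node // Nrm j s})) (by
          intro a b hab
          exact Subtype.ext (congrArg (fun x => x.1) hab))
      let π : T → C := fun τ => τ.2.2.choose
      have hπ : ∀ τ : T, Agr m τ.1 (h (π τ)) := fun τ => τ.2.2.choose_spec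
      have hπ' : ∀ (τ : T) κ, Agr m τ.1 (h κ) → π τ = κ := by
        intro τ κ hκ
        exact hinj (((hπ τ).symm.trans hκ).eq (hh _) (hh _))
      let v : T := ⟨Ω j, hΩ.nrm j, κ0, hc⟩
      obtain ⟨ℓ, R', h1, h2, h3, h4⟩ := hDL T π st.L (fun τ => st.θ τ.1) I.le
        (fun τ => I.nrm _ τ.2.1) (fun τ => I.agr _ _ τ.2.1 (hπ τ)) v (hπ' v κ0 hc) hokj
      let R : S.Node → S.Node := fun τ => if hτ : τ ∈ T then R' ⟨τ, hτ⟩ else st.θ τ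
      have hRT : ∀ τ : T, R τ.1 = R' τ := fun τ => by simp [R]
      have hRn : ∀ τ, τ ∉ T → R τ = st.θ τ := fun τ hτ => by simp [R, hτ]
      refine ⟨ℓ, R, ?_, ?_, ?_, ?_⟩
      · have hE : Ext Ω st.L ℓ T st.θ R := by
          apply Ext.of_subtype
          refine h1.congr (fun _ _ => Agr.refl _ _) (fun τ _ => ?_)
          rw [hRT]; exact Agr.refl _ _
        refine hE.nz ?_ ?_
        · intro τ hτ
          by_cases hτT : τ ∈ T
          · exact hE.agr τ hτT
          · rw [hRn τ hτT]; exact Agr.refl _ _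
        · intro τ hτ hτT k hk _
          rw [hRn τ hτT]
          exact I.nrm τ hτ k hk
      · intro τ hτ
        by_cases hτT : τ ∈ T
        · rw [hRT ⟨τ, hτT⟩]; exact h2 _
        · rw [hRn τ hτT]
          exact (I.nrm τ hτ).mono h1.le
      · rw [h3]; exact (hRT v).symm
      · intro s hs1 hs2 hs3 hs4
        let s' : C → T := fun κ => ⟨s κ, hs1 κ, κ, hs2 κ⟩
        have := h4 s' (fun κ => hπ' _ _ (hs2 κ)) (Subtype.ext hs3) hs4
        rw [← this]
        congr 1
        funext κ
        exact hRT (s' κ)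
    · obtain ⟨ℓ, hℓ, hℓq⟩ := hΩ.gen st.L _ (I.nrm _ (hΩ.nrm j)) hokj
      refine ⟨ℓ, st.θ, hΩ.free.ext_zero hℓ _ _ (fun τ hτ => I.nrm τ hτ),
        fun τ hτ => (I.nrm τ hτ).mono hℓ, hℓq, ?_⟩
      intro s _ hs2 hs3
      exact (hc (hs3 ▸ hs2 κ0)).elim
  have hnN : Nonempty (S.Node → S.Node) := ⟨fun τ => τ⟩
  choose! ℓf Rf hf1 hf2 hf3 hf4 using hstep
  let θ0 : S.Node → S.Node := fun τ => if hτ : ∃ κ, τ = h κ then e0 hτ.choose else τ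
  have hθ0 : ∀ κ, θ0 (h κ) = e0 κ := by
    intro κ
    have hτ : ∃ κ', h κ = h κ' := ⟨κ, rfl⟩
    simp only [θ0, dif_pos hτ]
    rw [← hinj hτ.choose_spec]
  have hθ0' : ∀ τ, (¬ ∃ κ, τ = h κ) → θ0 τ = τ := fun τ hτ => by simp only [θ0, dif_neg hτ]
  have hE0 : Ext Ω m L0 {τ | Nrm m τ} id θ0 := by
    have hE : Ext Ω m L0 (Set.range h) id θ0 := by
      apply Ext.of_subtype
      have := hext0.reindex (fun τ : Set.range h => τ.2.choose) Set.univ (fun _ _ => trivial)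
      refine this.congr (fun τ _ => ?_) (fun τ _ => ?_)
      · have := τ.2.choose_spec
        simp only [id]
        rw [this]; exact Agr.refl _ _
      · have := τ.2.choose_spec
        rw [← hθ0, this]; exact Agr.refl _ _
    refine hE.nz ?_ ?_
    · intro τ hτ
      by_cases hτT : τ ∈ Set.range h
      · exact hE.agr τ hτT
      · rw [hθ0' τ (by rintro ⟨κ, rfl⟩; exact hτT ⟨κ, rfl⟩)]; exact Agr.refl _ _
    · intro τ hτ hτT k hk _
      rw [hθ0' τ (by rintro ⟨κ, rfl⟩; exact hτT ⟨κ, rfl⟩)]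
      exact hτ k hk
  let st0 : PSt S := ⟨fun i => i, L0, θ0⟩
  have I0 : PInv Ω m h L0 e0 m st0 := by
    refine ⟨?_, ?_, ?_, ?_, ?_, le_rfl, ?_⟩
    · intro τ hτ
      by_cases hτT : ∃ κ, τ = h κ
      · obtain ⟨κ, rfl⟩ := hτT
        change Nrm L0 (θ0 (h κ))
        rw [hθ0]; exact he0 κ
      · change Nrm L0 (θ0 τ)
        rw [hθ0' τ hτT]; exact hτ.mono hext0.le
    · intro i hi
      exact hi.trans_le hext0.le
    · intro τ hτ
      exact (hE0.agr τ hτ).1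
    · intro τ hτ i hi
      exact (hE0.agr τ hτ).2 i hi
    · intro W _ w l hw h0
      exact hE0.ok W w l hw h0
    · intro τ κ hτ hκ
      have : τ = h κ := hκ.eq hτ (hh κ)
      subst this
      change Agr L0 (θ0 (h κ)) _
      rw [hθ0]; exact Agr.refl _ _
  let st : ℕ → PSt S := fun t => Nat.rec st0 (fun t s => s.next (m + t) (ℓf (m + t) s) (Rf (m + t) s)) t
  have hst : ∀ t, st (t + 1) = (st t).next (m + t) (ℓf (m + t) (st t)) (Rf (m + t) (st t)) := fun t => rfl
  have hI : ∀ t, PInv Ω m h L0 e0 (m + t) (st t) := by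
    intro t
    induction t with
    | zero => exact I0
    | succ t ih =>
      rw [hst]
      exact ih.next hΩ (by omega) (hf1 _ _ (by omega) ih) (hf2 _ _ (by omega) ih) (hf3 _ _ (by omega) ih)
  let lv : ℕ → ℕ := fun t => ℓf (m + t) (st t)
  let R : ℕ → S.Node → S.Node := fun t => Rf (m + t) (st t)
  have hR1 : ∀ t, Ext Ω (st t).L (lv t) {τ | Nrm (m + t) τ} (st t).θ (R t) := fun t =>
    hf1 _ _ (by omega) (hI t)
  have hR2 : ∀ t τ, Nrm (m + t) τ → Nrm (lv t) (R t τ) := fun t => hf2 _ _ (by omega) (hI t)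
  have hR3 : ∀ t, Ω (lv t) = R t (Ω (m + t)) := fun t => hf3 _ _ (by omega) (hI t)
  have hL : ∀ t, (st (t + 1)).L = lv t + 1 := fun t => rfl
  have hlvL : ∀ t, (st t).L ≤ lv t := fun t => (hR1 t).le
  have hθs : ∀ t τ, Agr (lv t) ((st (t + 1)).θ τ) (R t (trunc (m + t) τ)) := by
    intro t τ
    refine ⟨rfl, fun i hi => ?_⟩
    rw [hst]
    simp only [PSt.next]
    rw [Function.update_of_ne hi.ne]
  have hLmono : ∀ t d, (st t).L ≤ (st (t + d)).L := by
    intro t d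
    induction d with
    | zero => exact le_rfl
    | succ d ih =>
      rw [← add_assoc, hL]
      have := hlvL (t + d)
      omega
  -- agreement of later states
  have hA1 : ∀ t d τ, Agr (st t).L ((st (t + d)).θ (trunc (m + (t + d)) τ)) ((st t).θ (trunc (m + t) τ)) := by
    intro t d τ
    induction d with
    | zero => exact Agr.refl _ _
    | succ d ih =>
      refine Agr.trans ?_ ih
      refine Agr.mono ?_ (hLmono t d)
      have h1 := (hθs (t + d) (trunc (m + (t + d + 1)) τ)).mono (hlvL (t + d))
      have h2 := (hR1 (t + d)).agr _ (trunc_nrm (m + (t + d)) (trunc (m + (t + d + 1)) τ))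
      have h3 : trunc (m + (t + d)) (trunc (m + (t + d + 1)) τ) = trunc (m + (t + d)) τ :=
        trunc_eq_iff.2 ((trunc_agr _ _).mono (by omega))
      have h4 := h1.trans h2
      rw [h3] at h4
      exact h4
  have hA2 : ∀ t d, Agr (st t).L (Ω (lv (t + d))) ((st t).θ (trunc (m + t) (Ω (m + (t + d))))) := by
    intro t d
    have h1 := hA1 t d (Ω (m + (t + d)))
    rw [trunc_of_nrm (hΩ.nrm (m + (t + d)))] at h1
    refine Agr.trans ?_ h1
    rw [hR3]
    exact ((hR1 (t + d)).agr _ (hΩ.nrm _)).mono (hLmono t d)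
  have hA3 : ∀ t d, Agr (lv t) (Ω (lv (t + d))) (R t (trunc (m + t) (Ω (m + (t + d))))) := by
    intro t d
    rcases d with _ | d
    · rw [add_zero, hR3, trunc_of_nrm (hΩ.nrm _)]; exact Agr.refl _ _
    · have h1 := hA2 (t + 1) d
      rw [hL] at h1
      have e : t + 1 + d = t + (d + 1) := by omega
      rw [e] at h1
      have h2 := h1.mono (Nat.le_succ _)
      have h3 := h2.trans (hθs t _)
      have h4 : trunc (m + t) (trunc (m + (t + 1)) (Ω (m + (t + (d + 1))))) =
        trunc (m + t) (Ω (m + (t + (d + 1)))) := trunc_eq_iff.2 ((trunc_agr _ _).mono (by omega))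
      rw [h4] at h3
      exact h3
  let G : ℕ → ℕ := fun i => if i < m then i else lv (i - m)
  have hG1 : ∀ i, i < m → G i = i := fun i hi => by simp [G, hi]
  have hG2 : ∀ t, G (m + t) = lv t := fun t => by simp [G]
  have hcase : ∀ i, i < m ∨ ∃ t, i = m + t := fun i => by
    by_cases hi : i < m
    · exact Or.inl hi
    · exact Or.inr ⟨i - m, by omega⟩
  -- the recorded values
  have hg : ∀ t i, i < m + t → (st t).g i = G i := by
    intro t
    induction t with
    | zero => intro i hi; exact (hG1 i hi).symm
    | succ t ih =>
      intro i hi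
      rw [hst]
      simp only [PSt.next]
      by_cases hit : i = m + t
      · subst hit
        rw [Function.update_self, hG2]
      · rw [Function.update_of_ne hit]
        exact ih i (by omega)
  have hGL : ∀ t i, i < m + t → G i < (st t).L := fun t i hi => by
    rw [← hg t i hi]; exact (hI t).lt i hi
  have hagm : ∀ i, Agr m (Ω (G i)) (Ω i) := by
    intro i
    rcases hcase i with hi | ⟨t, rfl⟩
    · rw [hG1 i hi]; exact Agr.refl _ _
    · rw [hG2]
      have h1 := hA2 0 t
      rw [zero_add] at h1
      have h2 := h1.mono hext0.le
      have h3 := hE0.agr _ (trunc_nrm m (Ω (m + t)))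
      exact (h2.trans h3).trans (trunc_agr _ _)
  have hmono : ∀ i j, i < j → G i < G j := by
    intro i j hij
    rcases hcase j with hj | ⟨t, rfl⟩
    · rw [hG1 i (hij.trans hj), hG1 j hj]; exact hij
    · rw [hG2]
      exact (hGL t i hij).trans_le (hlvL t)
  refine ⟨G, ⟨fun i _ j _ => hmono i j, ?_, ?_, ?_, ?_⟩, hG1, hagm, ε, ?_⟩
  · intro i _
    exact (hagm i).1
  · intro i _ j _ hij
    rcases hcase j with hj | ⟨t, rfl⟩
    · rw [hG1 i (hij.trans hj), hG1 j hj]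
    · rw [hG2]
      have h1 := (hA2 t 0).2 (G i) (hGL t i hij)
      rw [add_zero, trunc_of_nrm (hΩ.nrm _)] at h1
      rw [h1, ← hg t i hij]
      exact (hI t).lab _ (hΩ.nrm _) i hij
  · intro k _ i _ j _ hki hkj ha
    rcases hcase k with hk | ⟨t, rfl⟩
    · rw [hG1 k hk]
      exact (((hagm i).mono hk.le).trans ha).trans ((hagm j).mono hk.le).symm
    · obtain ⟨d, rfl⟩ := Nat.exists_eq_add_of_le hki
      obtain ⟨d', rfl⟩ := Nat.exists_eq_add_of_le hkj
      rw [add_assoc, add_assoc] at *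
      rw [hG2, hG2, hG2]
      refine (hA3 t d).trans (Agr.trans ?_ (hA3 t d').symm)
      rw [trunc_eq_iff.2 ha]
      exact Agr.refl _ _
  · intro k _ W _ w hw l h0
    rcases hcase k with hk | ⟨t, rfl⟩
    · rw [hG1 k hk]
      exact h0.congr le_rfl (fun x => ((hagm (w x)).mono hk.le).symm)
    · rw [hG2]
      have h1 : OK Ω (m + t) (fun x => trunc (m + t) (Ω (w x))) l :=
        h0.congr le_rfl (fun x => (trunc_agr _ _).symm)
      have h2 := (hI t).ok W _ l (fun x => trunc_nrm _ _) h1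
      have h3 := (hR1 t).ok W (fun x => trunc (m + t) (Ω (w x))) l (fun x => trunc_nrm _ _) h2
      refine h3.congr le_rfl (fun x => ?_)
      obtain ⟨d, hd⟩ := Nat.exists_eq_add_of_le (hw x).2
      rw [hd, add_assoc, hG2]
      exact (hA3 t d).symm
  · intro i hm hle hext
    obtain ⟨t, ht⟩ := Nat.exists_eq_add_of_le hm
    rw [ht] at hle hext ⊢
    rw [hG2]
    have hd : ∀ κ, ∃ d, i κ = m + (t + d) := fun κ => by
      obtain ⟨d, hd⟩ := Nat.exists_eq_add_of_le (hle κ)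
      exact ⟨d, by omega⟩
    choose d hd using hd
    have key := hf4 (m + t) (st t) (by omega) (hI t) (fun κ => trunc (m + t) (Ω (i κ)))
      (fun κ => trunc_nrm _ _)
      (fun κ => ((trunc_agr (m + t) (Ω (i κ))).mono (by omega)).trans (hext.agr κ trivial))
      (by rw [ht]; exact trunc_of_nrm (hΩ.nrm _))
      ⟨(hI t).le, fun κ _ => (hI t).agr _ _ (trunc_nrm _ _)
          (((trunc_agr (m + t) (Ω (i κ))).mono (by omega)).trans (hext.agr κ trivial)), by
        intro W _ w l hw h0
        have h1 : OK Ω m (fun x => h (w x)) l := h0.congr hext0.le (fun x => hext0.agr _ trivial)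
        have h2 := hext.ok W w l (fun _ => trivial) h1
        exact (hI t).ok W _ l (fun x => trunc_nrm _ _) (h2.congr le_rfl (fun x => (trunc_agr _ _).symm))⟩
    rw [← key]
    change ψ (lv t) _ = ψ (lv t) _
    congr 1
    funext κ
    refine Agr.eq ?_ (trunc_nrm _ _) (hR2 t _ (trunc_nrm _ _))
    refine (trunc_agr _ _).trans ?_
    rw [hd κ, hG2]
    exact hA3 t (d κ)

end BRSys

end Part4

section Part5

namespace BRSys

variable {S : BRSys}

/-- level after the first `k` values -/
def lvl (g : ℕ → ℕ) : ℕ → ℕ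
  | 0 => 0
  | k + 1 => g k + 1

theorem lvl_congr {g g' : ℕ → ℕ} {k : ℕ} (h : ∀ i < k, g i = g' i) : lvl g k = lvl g' k := by
  cases k with
  | zero => rfl
  | succ k => simp [lvl, h k (Nat.lt_succ_self k)]

theorem SEmb.lt_lvl {n : ℕ} {P q : ℕ → S.Node} {g : ℕ → ℕ} (h : SEmb (Set.Iio n) P q g) {k i : ℕ}
    (hk : k ≤ n) (hi : i < k) : g i < lvl g k := by
  cases k with
  | zero => omega
  | succ k =>
    have := h.le (i := i) (j := k) (by simp; omega) (by simp; omega) (by omega)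
    simp only [lvl]; omega

theorem SEmb.lvl_le {n : ℕ} {P q : ℕ → S.Node} {g : ℕ → ℕ} (h : SEmb (Set.Iio n) P q g) {k i : ℕ}
    (hi : i < n) (hk : k ≤ i) : lvl g k ≤ g i := by
  cases k with
  | zero => exact Nat.zero_le _
  | succ k => exact h.mono k (by simp; omega) i (by simpa using hi) (by omega)

/-- equivalence of strong embeddings up to stage `k` -/
def Eqv (Ω : ℕ → S.Node) (n k : ℕ) (g g' : ℕ → ℕ) : Prop :=
  (∀ i < k, g i = g' i) ∧ ∀ i < n, Agr (lvl g k) (Ω (g i)) (Ω (g' i))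

/-- a colouring respects equivalence -/
def Resp (Ω P : ℕ → S.Node) (n k : ℕ) {Γ : Type} (χ : (ℕ → ℕ) → Γ) : Prop :=
  ∀ g g', SEmb (Set.Iio n) P Ω g → SEmb (Set.Iio n) P Ω g' → Eqv Ω n k g g' → χ g = χ g'

/-- strong embeddings fixing an initial segment -/
structure Fix (Ω : ℕ → S.Node) (m : ℕ) (G : ℕ → ℕ) : Prop where
  emb : SEmb Set.univ Ω Ω G
  fix : ∀ i < m, G i = i
  agr : ∀ i, Agr m (Ω (G i)) (Ω i)

theorem Fix.id (Ω : ℕ → S.Node) (m : ℕ) : Fix Ω m (fun i => i) :=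
  ⟨SEmb.id _ _, fun _ _ => rfl, fun _ => Agr.refl _ _⟩

theorem Fix.comp {Ω : ℕ → S.Node} {m : ℕ} {G G' : ℕ → ℕ} (h : Fix Ω m G) (h' : Fix Ω m G') :
    Fix Ω m (fun i => G (G' i)) :=
  ⟨h'.emb.comp h.emb, fun i hi => by rw [h'.fix i hi, h.fix i hi],
    fun i => (h.agr _).trans (h'.agr i)⟩

theorem Fix.mono {Ω : ℕ → S.Node} {m m' : ℕ} {G : ℕ → ℕ} (h : Fix Ω m G) (hm : m' ≤ m) : Fix Ω m' G :=
  ⟨h.emb, fun i hi => h.fix i (hi.trans_le hm), fun i => (h.agr i).mono hm⟩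

theorem Resp.comp {Ω P : ℕ → S.Node} {n k : ℕ} {Γ : Type} {χ : (ℕ → ℕ) → Γ} (hk : k ≤ n)
    (h : Resp Ω P n k χ) {F : ℕ → ℕ} (hF : SEmb Set.univ Ω Ω F) :
    Resp Ω P n k (fun g => χ (fun i => F (g i))) := by
  intro g g' hg hg' he
  refine h _ _ (hg.comp hF) (hg'.comp hF) ⟨fun i hi => congrArg F (he.1 i hi), fun i hi => ?_⟩
  by_cases hik : i < k
  · simp only [he.1 i hik]; exact Agr.refl _ _
  · have h1 : lvl g k ≤ g i := hg.lvl_le hi (by omega)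
    have h2 : lvl g k ≤ g' i := by rw [lvl_congr he.1]; exact hg'.lvl_le hi (by omega)
    have h3 := hF.agr (lvl g k) trivial _ trivial _ trivial h1 h2 (he.2 i hi)
    refine h3.mono ?_
    cases k with
    | zero => exact Nat.zero_le _
    | succ k => exact hF.mono _ trivial _ trivial (Nat.lt_succ_self _)

theorem class_lemma {Ω P : ℕ → S.Node} (hΩ : Gen Ω) {n k : ℕ} (hk : k < n) {Γ : Type} [Finite Γ]
    {χ : (ℕ → ℕ) → Γ} (hχ : Resp Ω P n (k + 1) χ) {g0 : ℕ → ℕ} (hg0 : SEmb (Set.Iio n) P Ω g0) :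
    ∃ G, Fix Ω (lvl g0 k) G ∧ ∃ ε, ∀ g, SEmb (Set.Iio n) P Ω g → Eqv Ω n k g0 g →
      χ (fun i => G (g i)) = ε := by
  classical
  set m := lvl g0 k with hm
  let C : Type := ↥(Set.range (fun i : {i : Fin n // k ≤ i.1} => trunc k (P i.1.1)))
  have hCfin : Finite C := by
    change Finite ↥(Set.range _)
    infer_instance
  let κ0 : C := ⟨trunc k (P k), ⟨⟨⟨k, hk⟩, le_rfl⟩, rfl⟩⟩
  have hρ : ∀ κ : C, ∃ i, i < n ∧ k ≤ i ∧ trunc k (P i) = κ.1 ∧ (κ = κ0 → i = k) := by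
    intro κ
    by_cases hκ : κ = κ0
    · subst hκ; exact ⟨k, hk, le_rfl, rfl, fun _ => rfl⟩
    · obtain ⟨⟨i, hi⟩, hi2⟩ := κ.2
      exact ⟨i, i.2, hi, hi2, fun h => (hκ h).elim⟩
  choose ρ hρ1 hρ2 hρ3 hρ4 using hρ
  have hcls : ∀ i, i < n → k ≤ i → ∃ κ, Agr k (P i) (P (ρ κ)) := by
    intro i hi hki
    let κ : C := ⟨trunc k (P i), ⟨⟨⟨i, hi⟩, hki⟩, rfl⟩⟩
    exact ⟨κ, (trunc_eq_iff.1 (hρ3 κ)).symm⟩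
  let h : C → S.Node := fun κ => trunc m (Ω (g0 (ρ κ)))
  have hinj : Function.Injective h := by
    intro κ κ' he
    have he' : Agr m (Ω (g0 (ρ κ))) (Ω (g0 (ρ κ'))) := trunc_eq_iff.1 he
    have : Agr k (P (ρ κ)) (P (ρ κ')) := by
      refine ⟨?_, fun i hi => ?_⟩
      · rw [← hg0.un _ (by simpa using hρ1 κ), ← hg0.un _ (by simpa using hρ1 κ')]; exact he'.1
      · rw [← hg0.lab i (by simp; omega) _ (by simpa using hρ1 κ) (hi.trans_le (hρ2 κ)),
          ← hg0.lab i (by simp; omega) _ (by simpa using hρ1 κ') (hi.trans_le (hρ2 κ'))]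
        exact he'.2 _ (hg0.lt_lvl hk.le hi)
    have h2 := trunc_eq_iff.2 this
    rw [hρ3, hρ3] at h2
    exact Subtype.ext h2
  have hρ0 : ρ κ0 = k := hρ4 κ0 rfl
  have hok : OKp Ω m (h κ0) := by
    have := hΩ.okp (g0 k)
    refine this.congr (hg0.lvl_le hk le_rfl) (fun _ => ?_)
    simp only [h, hρ0]
    exact (trunc_agr _ _).symm
  let Q : ℕ → (C → S.Node) → (ℕ → ℕ) → Prop := fun ℓ e g1 => SEmb (Set.Iio n) P Ω g1 ∧
    (∀ i < k, g1 i = g0 i) ∧ g1 k = ℓ ∧ ∀ κ, trunc ℓ (Ω (g1 (ρ κ))) = e κ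
  let ψ : ℕ → (C → S.Node) → Γ := fun ℓ e => if hex : ∃ g1, Q ℓ e g1 then χ hex.choose else χ g0
  obtain ⟨G, hG, hfix, hagr, ε, hε⟩ := pigeon hΩ C κ0 m h (fun κ => trunc_nrm _ _) hinj hok Γ ψ
  have hFix : Fix Ω m G := ⟨hG, hfix, hagr⟩
  refine ⟨G, hFix, ε, ?_⟩
  intro g hg he
  have hmg : lvl g k = m := (lvl_congr he.1).symm
  have key := hε (fun κ => g (ρ κ)) (by
      simp only [hρ0]; rw [← hmg]; exact hg.lvl_le hk le_rfl)
    (fun κ => by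
      simp only [hρ0]
      exact hg.le (by simpa using hk) (by simpa using hρ1 κ) (hρ2 κ))
    ⟨by simp only [hρ0]; rw [← hmg]; exact hg.lvl_le hk le_rfl,
      fun κ _ => (he.2 _ (hρ1 κ)).symm.trans (trunc_agr _ _).symm, by
      intro W _ w l _ h0
      simp only [hρ0]
      have h1 : OK Ω m (fun x => Ω (g0 (ρ (w x)))) l := h0.congr le_rfl (fun x => trunc_agr _ _)
      have h2 := hg0.ok_back (k := k) (m := m)
        (fun i hi => ⟨by simp; omega, hg0.lt_lvl hk.le hi⟩)
        (fun x => ρ (w x)) (fun x => ⟨by simpa using hρ1 (w x), hρ2 (w x)⟩) h1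
      exact hg.ok k (by simpa using hk) W (fun x => ρ (w x))
        (fun x => ⟨by simpa using hρ1 (w x), hρ2 (w x)⟩) l h2⟩
  simp only [hρ0] at key
  have hex : ∃ g1, Q (G (g k)) (fun κ => trunc (G (g k)) (Ω (G (g (ρ κ))))) g1 :=
    ⟨fun i => G (g i), hg.comp hG, fun i hi => by
      simp only
      rw [← he.1 i hi]
      exact hfix _ (hg0.lt_lvl hk.le hi), rfl, fun κ => rfl⟩
  simp only [ψ, dif_pos hex] at key
  rw [← key]
  obtain ⟨s1, s2, s3, s4⟩ := hex.choose_spec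
  generalize hex.choose = g1 at s1 s2 s3 s4
  symm
  refine hχ _ _ s1 (hg.comp hG) ⟨?_, ?_⟩
  · intro i hi
    rcases Nat.lt_succ_iff_lt_or_eq.1 hi with hi | rfl
    · have h1 : g1 i = G (g i) := by
        rw [s2 i hi, ← he.1 i hi]
        exact (hfix _ (hg0.lt_lvl hk.le hi)).symm
      exact h1
    · exact s3
  · intro i hi
    by_cases hik : i < k
    · have h1 : g1 i = G (g i) := by
        rw [s2 i hik, ← he.1 i hik]
        exact (hfix _ (hg0.lt_lvl hk.le hik)).symm
      rw [h1]; exact Agr.refl _ _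
    · rcases (not_lt.1 hik).eq_or_lt with rfl | hki
      · rw [s3]; exact Agr.refl _ _
      · obtain ⟨κ, hκ⟩ := hcls i hi hki.le
        have a1 := s1.agr k (by simpa using hk) i (by simpa using hi) (ρ κ) (by simpa using hρ1 κ)
          hki.le (hρ2 κ) hκ
        have a2 := (hg.comp hG).agr k (by simpa using hk) i (by simpa using hi) (ρ κ)
          (by simpa using hρ1 κ) hki.le (hρ2 κ) hκ
        rw [s3] at a1
        have a3 := trunc_eq_iff.1 (s4 κ)
        have a4 := (a1.trans a3).trans a2.symm
        refine ⟨a4.1, fun j hj => ?_⟩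
        simp only [lvl, s3] at hj
        rcases Nat.lt_succ_iff_lt_or_eq.1 hj with hj | rfl
        · exact a4.2 j hj
        · have b1 := s1.lab k (by simpa using hk) i (by simpa using hi) hki
          have b2 := (hg.comp hG).lab k (by simpa using hk) i (by simpa using hi) hki
          rw [s3] at b1
          rw [b1, b2]

theorem Fix.eqv {Ω : ℕ → S.Node} {m n k : ℕ} {G g : ℕ → ℕ} {P : ℕ → S.Node} (hG : Fix Ω m G)
    (hg : SEmb (Set.Iio n) P Ω g) (hk : k ≤ n) (hm : lvl g k ≤ m) : Eqv Ω n k g (fun i => G (g i)) := by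
  refine ⟨fun i hi => (hG.fix _ ((hg.lt_lvl hk hi).trans_le hm)).symm, fun i _ => ?_⟩
  exact ((hG.agr _).mono hm).symm

theorem Eqv.symm {Ω : ℕ → S.Node} {n k : ℕ} {g g' : ℕ → ℕ} (h : Eqv Ω n k g g') : Eqv Ω n k g' g :=
  ⟨fun i hi => (h.1 i hi).symm, fun i hi => by
    rw [← lvl_congr h.1]; exact (h.2 i hi).symm⟩

theorem Eqv.trans {Ω : ℕ → S.Node} {n k : ℕ} {g g' g'' : ℕ → ℕ} (h : Eqv Ω n k g g')
    (h' : Eqv Ω n k g' g'') : Eqv Ω n k g g'' :=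
  ⟨fun i hi => (h.1 i hi).trans (h'.1 i hi), fun i hi => (h.2 i hi).trans (by
    rw [lvl_congr h.1]; exact h'.2 i hi)⟩

theorem level_lemma {Ω P : ℕ → S.Node} (hΩ : Gen Ω) {n k : ℕ} (hk : k < n) {Γ : Type} [Finite Γ]
    {χ : (ℕ → ℕ) → Γ} (hχ : Resp Ω P n (k + 1) χ) (m : ℕ) :
    ∃ G, Fix Ω m G ∧ ∀ g g', SEmb (Set.Iio n) P Ω g → SEmb (Set.Iio n) P Ω g' → Eqv Ω n k g g' →
      lvl g k = m → χ (fun i => G (g i)) = χ (fun i => G (g' i)) := by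
  classical
  have := finite_nrm (S := S) m
  let Q := (Fin k → Fin (m + 1)) × (Fin n → {τ : S.Node // Nrm m τ})
  have := Fintype.ofFinite Q
  let cl : (ℕ → ℕ) → Q := fun g => (fun i => ⟨min (g i) m, by omega⟩, fun i => ⟨trunc m (Ω (g i)), trunc_nrm _ _⟩)
  have hcl : ∀ g g', SEmb (Set.Iio n) P Ω g → SEmb (Set.Iio n) P Ω g' → lvl g k = m → lvl g' k = m →
      cl g = cl g' → Eqv Ω n k g g' := by
    intro g g' hg hg' hm hm' he
    have he1 := congrArg Prod.fst he
    have he2 := congrArg Prod.snd he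
    refine ⟨fun i hi => ?_, fun i hi => ?_⟩
    · have h1 := congrArg Fin.val (congrFun he1 ⟨i, hi⟩)
      have h2 := hg.lt_lvl hk.le hi
      have h3 := hg'.lt_lvl hk.le hi
      simp only [cl] at h1
      omega
    · have h1 := congrArg Subtype.val (congrFun he2 ⟨i, hi⟩)
      rw [hm]
      exact trunc_eq_iff.1 h1
  have hcl' : ∀ g g', SEmb (Set.Iio n) P Ω g → SEmb (Set.Iio n) P Ω g' → lvl g k = m →
      Eqv Ω n k g g' → cl g = cl g' := by
    intro g g' hg hg' hm he
    refine Prod.ext (funext fun i => ?_) (funext fun i => ?_)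
    · exact Fin.ext (by simp [cl, he.1 i i.2])
    · refine Subtype.ext ?_
      have := he.2 i i.2
      rw [hm] at this
      exact trunc_eq_iff.2 this
  have main : ∀ T : Finset Q, ∃ G, Fix Ω m G ∧ ∀ g g', SEmb (Set.Iio n) P Ω g →
      SEmb (Set.Iio n) P Ω g' → Eqv Ω n k g g' → lvl g k = m → cl g ∈ T →
      χ (fun i => G (g i)) = χ (fun i => G (g' i)) := by
    intro T
    induction T using Finset.induction_on with
    | empty => exact ⟨fun i => i, Fix.id _ _, fun g g' _ _ _ _ h => by simp at h⟩
    | insert c T _ ih =>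
      obtain ⟨G, hG, h1⟩ := ih
      by_cases hc : ∃ g0, SEmb (Set.Iio n) P Ω g0 ∧ lvl g0 k = m ∧ cl g0 = c
      · obtain ⟨g0, hg0, hm0, hc0⟩ := hc
        obtain ⟨G', hG', ε, hε⟩ := class_lemma hΩ hk (hχ.comp hk hG.emb) hg0
        rw [hm0] at hG'
        refine ⟨fun i => G (G' i), hG.comp hG', ?_⟩
        intro g g' hg hg' he hm hT
        have hm' : lvl g' k = m := by rw [← lvl_congr he.1]; exact hm
        rcases Finset.mem_insert.1 hT with hT | hT
        · have e1 : Eqv Ω n k g0 g := hcl _ _ hg0 hg hm0 hm (hc0.trans hT.symm)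
          exact (hε g hg e1).trans (hε g' hg' (e1.trans he)).symm
        · have e1 := hG'.eqv hg hk.le hm.le
          have e2 := hG'.eqv hg' hk.le hm'.le
          refine h1 _ _ (hg.comp hG'.emb) (hg'.comp hG'.emb) ((e1.symm.trans he).trans e2) ?_ ?_
          · rw [← lvl_congr e1.1]; exact hm
          · rw [← hcl' _ _ hg (hg.comp hG'.emb) hm e1]; exact hT
      · refine ⟨G, hG, ?_⟩
        intro g g' hg hg' he hm hT
        rcases Finset.mem_insert.1 hT with hT | hT
        · exact (hc ⟨g, hg, hm, hT⟩).elim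
        · exact h1 g g' hg hg' he hm hT
  obtain ⟨G, hG, h1⟩ := main Finset.univ
  exact ⟨G, hG, fun g g' hg hg' he hm => h1 g g' hg hg' he hm (Finset.mem_univ _)⟩

theorem claim_k {Ω P : ℕ → S.Node} (hΩ : Gen Ω) {n k : ℕ} (hk : k < n) {Γ : Type} [Finite Γ]
    {χ : (ℕ → ℕ) → Γ} (hloc : ∀ g g' : ℕ → ℕ, (∀ i < n, g i = g' i) → χ g = χ g')
    (hχ : Resp Ω P n (k + 1) χ) :
    ∃ F, SEmb Set.univ Ω Ω F ∧ Resp Ω P n k (fun g => χ (fun i => F (g i))) := by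
  classical
  have hstep : ∀ (m : ℕ) (H : ℕ → ℕ), SEmb Set.univ Ω Ω H → ∃ G, Fix Ω m G ∧ ∀ g g',
      SEmb (Set.Iio n) P Ω g → SEmb (Set.Iio n) P Ω g' → Eqv Ω n k g g' →
      lvl g k = m → χ (fun i => H (G (g i))) = χ (fun i => H (G (g' i))) := fun m H hH =>
    level_lemma hΩ hk (hχ.comp hk hH) m
  choose! Gf hGf1 hGf2 using hstep
  let H : ℕ → ℕ → ℕ := fun m => Nat.rec (fun i => i) (fun m h => fun i => h (Gf m h i)) m
  have hHs : ∀ m i, H (m + 1) i = H m (Gf m (H m) i) := fun m i => rfl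
  have hH : ∀ m, SEmb Set.univ Ω Ω (H m) := by
    intro m
    induction m with
    | zero => exact SEmb.id _ _
    | succ m ih => exact (hGf1 m (H m) ih).emb.comp ih
  have hstab : ∀ m d, ∃ G, Fix Ω m G ∧ ∀ i, H (m + d) i = H m (G i) := by
    intro m d
    induction d with
    | zero => exact ⟨fun i => i, Fix.id _ _, fun i => rfl⟩
    | succ d ih =>
      obtain ⟨G, hG, h1⟩ := ih
      refine ⟨fun i => G (Gf (m + d) (H (m + d)) i),
        hG.comp ((hGf1 (m + d) (H (m + d)) (hH _)).mono (by omega)), fun i => ?_⟩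
      rw [← add_assoc, hHs, h1]
  let F : ℕ → ℕ := fun i => H (i + 1) i
  have hF : ∀ M i, i < M → F i = H M i := by
    intro M i hi
    obtain ⟨d, rfl⟩ := Nat.exists_eq_add_of_le (Nat.succ_le_of_lt hi)
    obtain ⟨G, hG, h1⟩ := hstab (i + 1) d
    rw [Nat.succ_eq_add_one, h1, hG.fix i (Nat.lt_succ_self i)]
  refine ⟨F, ⟨?_, ?_, ?_, ?_, ?_⟩, ?_⟩
  · intro i _ j _ hij
    rw [hF (j + 1) i (by omega), hF (j + 1) j (by omega)]
    exact (hH (j + 1)).mono i trivial j trivial hij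
  · intro i _
    rw [hF (i + 1) i (by omega)]
    exact (hH (i + 1)).un i trivial
  · intro i _ j _ hij
    rw [hF (j + 1) i (by omega), hF (j + 1) j (by omega)]
    exact (hH (j + 1)).lab i trivial j trivial hij
  · intro k' _ i _ j _ hki hkj ha
    rw [hF (max i j + 1) i (by omega), hF (max i j + 1) j (by omega), hF (max i j + 1) k' (by omega)]
    exact (hH (max i j + 1)).agr k' trivial i trivial j trivial hki hkj ha
  · intro k' _ W _ w hw l h0
    obtain ⟨M, hM⟩ : ∃ M, ∀ x, w x < M := by
      obtain ⟨M, hM⟩ := (Set.finite_range w).bddAbove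
      exact ⟨M + 1, fun x => Nat.lt_succ_of_le (hM ⟨x, rfl⟩)⟩
    have h1 := (hH (max M (k' + 1))).ok k' trivial W w (fun x => ⟨trivial, (hw x).2⟩) l h0
    rw [hF (max M (k' + 1)) k' (by omega)]
    have : (fun x => Ω (F (w x))) = (fun x => Ω (H (max M (k' + 1)) (w x))) := by
      funext x
      rw [hF (max M (k' + 1)) (w x) (by have := hM x; omega)]
    rw [this]
    exact h1
  · intro g g' hg hg' he
    obtain ⟨M, hM, hM'⟩ : ∃ M, (∀ i < n, g i < M) ∧ ∀ i < n, g' i < M := by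
      refine ⟨(Finset.range n).sup (fun i => g i + g' i) + 1, fun i hi => ?_, fun i hi => ?_⟩ <;>
      · have : g i + g' i ≤ _ := Finset.le_sup (f := fun i => g i + g' i) (Finset.mem_range.2 hi)
        omega
    set m := lvl g k with hm
    have hm' : lvl g' k = m := (lvl_congr he.1).symm
    obtain ⟨G, hG, h1⟩ := hstab (m + 1) M
    have hFg : ∀ g : ℕ → ℕ, (∀ i < n, g i < M) →
        χ (fun i => F (g i)) = χ (fun i => H m (Gf m (H m) (G (g i)))) := by
      intro g hgM
      refine hloc _ _ (fun i hi => ?_)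
      rw [hF (m + 1 + M) (g i) (by have := hgM i hi; omega), h1, hHs]
    simp only
    rw [hFg g hM, hFg g' hM']
    have e1 := (hG.mono (Nat.le_succ m)).eqv hg hk.le le_rfl
    have e2 := (hG.mono (Nat.le_succ m)).eqv hg' hk.le hm'.le
    refine hGf2 m (H m) (hH m) _ _ (hg.comp hG.emb) (hg'.comp hG.emb) ((e1.symm.trans he).trans e2) ?_
    exact (lvl_congr e1.1).symm

theorem theorem_R {Ω : ℕ → S.Node} (hΩ : Gen Ω) (P : ℕ → S.Node) (n : ℕ) {Γ : Type} [Finite Γ]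
    (χ : (ℕ → ℕ) → Γ) (hloc : ∀ g g' : ℕ → ℕ, (∀ i < n, g i = g' i) → χ g = χ g') :
    ∃ F, SEmb Set.univ Ω Ω F ∧ ∀ g g', SEmb (Set.Iio n) P Ω g → SEmb (Set.Iio n) P Ω g' →
      χ (fun i => F (g i)) = χ (fun i => F (g' i)) := by
  have main : ∀ d, d ≤ n → ∃ F, SEmb Set.univ Ω Ω F ∧ Resp Ω P n (n - d) (fun g => χ (fun i => F (g i))) := by
    intro d
    induction d with
    | zero =>
      intro _
      exact ⟨fun i => i, SEmb.id _ _, fun g g' _ _ he => hloc _ _ (fun i hi => he.1 i (by omega))⟩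
    | succ d ih =>
      intro hd
      obtain ⟨F, hF, h1⟩ := ih (by omega)
      have e : n - d = n - (d + 1) + 1 := by omega
      rw [e] at h1
      obtain ⟨F', hF', h2⟩ := claim_k hΩ (k := n - (d + 1)) (by omega)
        (χ := fun g => χ (fun i => F (g i)))
        (fun g g' hgg => hloc _ _ (fun i hi => by rw [hgg i hi])) h1
      exact ⟨fun i => F (F' i), hF'.comp hF, h2⟩
  obtain ⟨F, hF, h1⟩ := main n le_rfl
  refine ⟨F, hF, fun g g' hg hg' => h1 g g' hg hg' ?_⟩
  rw [Nat.sub_self]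
  refine ⟨fun i hi => by omega, fun i hi => ⟨?_, fun j hj => by simp [lvl] at hj⟩⟩
  rw [hg.un i (by simpa using hi), hg'.un i (by simpa using hi)]

end BRSys

end Part5

section Part6

theorem BR_exists_seq {α : Type} [Inhabited α] (P : ℕ → (ℕ → α) → α → Prop)
    (hloc : ∀ m g g' a, (∀ i < m, g i = g' i) → P m g a → P m g' a)
    (hstep : ∀ m g, (∀ i < m, P i g (g i)) → ∃ a, P m g a) : ∃ g, ∀ m, P m g (g m) := by
  classical
  choose! st hst using hstep
  let G : ℕ → ℕ → α := fun m => Nat.rec (fun _ => default) (fun m g => Function.update g m (st m g)) m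
  have hG : ∀ m, G (m + 1) = Function.update (G m) m (st m (G m)) := fun m => rfl
  let g : ℕ → α := fun m => st m (G m)
  have hGg : ∀ m i, i < m → G m i = g i := by
    intro m
    induction m with
    | zero => intro i hi; omega
    | succ m ih =>
      intro i hi
      rw [hG]
      by_cases him : i = m
      · subst him; simp [g]
      · rw [Function.update_of_ne him]; exact ih i (by omega)
  refine ⟨g, fun m => ?_⟩
  induction m using Nat.strong_induction_on with
  | _ m ih =>
    have h1 : P m (G m) (st m (G m)) := by
      refine hst m (G m) (fun i hi => ?_)
      rw [hGg m i hi]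
      exact hloc i g (G m) _ (fun j hj => (hGg m j (hj.trans hi)).symm) (ih i hi)
    exact hloc m (G m) g _ (fun i hi => hGg m i hi) h1

namespace BRSys

variable {S : BRSys}

/-- OK only depends on an initial segment -/
theorem OK.congr_left {W : Type} {q q' : ℕ → S.Node} {ℓ : ℕ} {s : W → S.Node} {l : W → W → S.σ}
    (h : OK q ℓ s l) (hq : ∀ i < ℓ, q i = q' i) : OK q' ℓ s l := by
  refine h.transfer_map id ?_
  rintro (i | w) hx
  · refine ⟨fun j hj => hx j hj, ?_, ?_⟩
    · simp [un, hq i (hx i rfl)]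
    rintro (j | w) hy
    · simp [lab, hq i (hx i rfl), hq j (hy j rfl)]
    · rfl
  · refine ⟨fun j hj => hx j hj, rfl, ?_⟩
    rintro (j | w') hy <;> rfl

theorem OK_empty_of {q : ℕ → S.Node} (hB0 : ∀ u l, ¬ S.Bad 0 u l) {ℓ : ℕ} (h : ∀ j < ℓ, OKp q j (q j)) :
    OK q ℓ (fun x : Empty => x.elim) (fun x _ => x.elim) := by
  cases ℓ with
  | zero =>
    intro n f f1 _ f3
    cases n with
    | zero => exact hB0 _ _ f3
    | succ n =>
      rcases h0 : f 0 with i | x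
      · exact absurd (f1 0 i h0) (by omega)
      · exact x.elim
  | succ ℓ =>
    rw [OK_code]
    have := (h ℓ (Nat.lt_succ_self _)).reindex (fun _ : Option Empty => ())
    convert this using 1
    · funext x; rcases x with _ | x
      · rfl
      · exact x.elim
    · funext x y
      rcases x with _ | x
      · rcases y with _ | y
        · rfl
        · exact y.elim
      · exact x.elim

theorem OKp_zero {q : ℕ → S.Node} {ℓ : ℕ} {υ0 : S.υ}
    (hB1 : ∀ u l, (∀ a, u a = υ0) → (∀ a b, l a b = S.zero) → ¬ S.Bad 1 u l)
    (h : OK q ℓ (fun x : Empty => x.elim) (fun x _ => x.elim)) :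
    OKp q ℓ (υ0, fun _ => S.zero) := by
  intro n f f1 f2 f3
  by_cases hex : ∃ a, f a = Sum.inr ()
  · obtain ⟨a, ha⟩ := hex
    have hall : ∀ b, b = a := by
      intro b
      by_contra hb
      refine f2 b a hb ?_
      rw [ha]
      rcases f b with i | x <;> rfl
    have hn : n = 1 := by
      have : Subsingleton (Fin n) := ⟨fun x y => (hall x).trans (hall y).symm⟩
      have h1 := Fin.subsingleton_iff_le_one.1 this
      have := a.2
      omega
    subst hn
    refine hB1 _ _ (fun b => ?_) (fun b c => ?_) f3
    · rw [hall b, ha]; rfl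
    · rw [hall b, hall c, ha]; rfl
  · have hf : ∀ a, ∃ i, f a = Sum.inl i := by
      intro a
      rcases ha : f a with i | x
      · exact ⟨i, rfl⟩
      · exact (hex ⟨a, ha⟩).elim
    choose g hg using hf
    refine h n (fun a => Sum.inl (g a)) (fun a i hi => f1 a i ((hg a).trans (by simpa using hi)))
      (fun a b hab => ?_) ?_
    · have := f2 a b hab
      rw [hg a, hg b] at this; exact this
    · simp only [hg] at f3; exact f3

theorem countable_fs : Countable {s : S.Node // ∃ ℓ, Nrm ℓ s} := by
  have : {s : S.Node | ∃ ℓ, Nrm ℓ s} = ⋃ ℓ, {s : S.Node | Nrm ℓ s} := by ext; simp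
  have h2 : {s : S.Node | ∃ ℓ, Nrm ℓ s}.Countable := by
    rw [this]
    refine Set.countable_iUnion (fun ℓ => ?_)
    have : Finite ↑{s : S.Node | Nrm ℓ s} := finite_nrm (S := S) ℓ
    exact (Set.toFinite {s : S.Node | Nrm ℓ s}).countable
  exact h2.to_subtype

theorem exists_gen {υ0 : S.υ} (hB0 : ∀ u l, ¬ S.Bad 0 u l)
    (hB1 : ∀ u l, (∀ a, u a = υ0) → (∀ a b, l a b = S.zero) → ¬ S.Bad 1 u l) :
    ∃ Ω : ℕ → S.Node, Gen Ω := by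
  classical
  have := countable_fs (S := S)
  have : Nonempty {s : S.Node // ∃ ℓ, Nrm ℓ s} := ⟨⟨(υ0, fun _ => S.zero), 0, fun _ _ => rfl⟩⟩
  obtain ⟨ν, hν⟩ := exists_surjective_nat {s : S.Node // ∃ ℓ, Nrm ℓ s}
  let e : ℕ → S.Node := fun m => (ν (Nat.unpair m).1).1
  have : Inhabited S.Node := ⟨(υ0, fun _ => S.zero)⟩
  obtain ⟨Ω, hΩ⟩ := BR_exists_seq (α := S.Node) (fun m q t => Nrm m t ∧ OKp q m t ∧
      (Nrm m (e m) → OKp q m (e m) → t = e m)) (by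
    rintro m g g' a hg ⟨h1, h2, h3⟩
    exact ⟨h1, h2.congr_left hg, fun h4 h5 => h3 h4 (h5.congr_left (fun i hi => (hg i hi).symm))⟩) (by
    intro m g hg
    by_cases hc : Nrm m (e m) ∧ OKp g m (e m)
    · exact ⟨e m, hc.1, hc.2, fun _ _ => rfl⟩
    · exact ⟨(υ0, fun _ => S.zero), fun _ _ => rfl,
        OKp_zero hB1 (OK_empty_of hB0 (fun j hj => (hg j hj).2.1)), fun h1 h2 => (hc ⟨h1, h2⟩).elim⟩)
  refine ⟨Ω, fun j => (hΩ j).1, fun j => (hΩ j).2.1, fun ℓ t ht hok => ?_⟩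
  have hfree : Free Ω := free_of_OKp (fun j => (hΩ j).2.1)
  obtain ⟨a, ha⟩ := hν ⟨t, ℓ, ht⟩
  refine ⟨Nat.pair a ℓ, Nat.right_le_pair _ _, ?_⟩
  have he : e (Nat.pair a ℓ) = t := by simp [e, ha]
  have h3 := (hΩ (Nat.pair a ℓ)).2.2
  rw [he] at h3
  refine h3 (ht.mono (Nat.right_le_pair _ _)) ?_
  exact (hfree.ext_zero (I := Unit) (Nat.right_le_pair a ℓ) Set.univ (fun _ => t)
    (fun _ _ => ht)).okp (i := ()) trivial hok

/-- pushing a node forward along `g` -/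
noncomputable def push (g : ℕ → ℕ) (m : ℕ) (s : S.Node) : S.Node := by
  classical
  exact (s.1, fun z => if h : ∃ i, i < m ∧ g i = z then s.2 h.choose else S.zero)

theorem push_apply {g : ℕ → ℕ} {m : ℕ} (s : S.Node)
    (hinj : ∀ i < m, ∀ j < m, g i = g j → i = j) {i : ℕ} (hi : i < m) : (push g m s).2 (g i) = s.2 i := by
  have hex : ∃ i', i' < m ∧ g i' = g i := ⟨i, hi, rfl⟩
  simp only [push, dif_pos hex]
  rw [hinj _ hex.choose_spec.1 _ hi hex.choose_spec.2]

theorem push_zero {g : ℕ → ℕ} {m : ℕ} (s : S.Node) {z : ℕ} (h : (push g m s).2 z ≠ S.zero) :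
    ∃ i, i < m ∧ g i = z := by
  by_contra hcon
  exact h (by simp only [push, dif_neg hcon])

theorem push_congr {g g' : ℕ → ℕ} {m : ℕ} (s : S.Node) (h : ∀ i < m, g i = g' i) :
    push g m s = push g' m s := by
  have : ∀ z, (fun i => i < m ∧ g i = z) = (fun i => i < m ∧ g' i = z) := by
    intro z; funext i
    exact propext ⟨fun h1 => ⟨h1.1, by rw [← h i h1.1]; exact h1.2⟩,
      fun h1 => ⟨h1.1, by rw [h i h1.1]; exact h1.2⟩⟩
  simp only [push, this]

/-- Transfer along a pushed piece. -/
theorem push_ok {Ω q : ℕ → S.Node} (hΩ : Free Ω) {g : ℕ → ℕ} {m ℓ : ℕ}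
    (hmono : ∀ i < m, ∀ j < m, i < j → g i < g j)
    (hg : ∀ i < m, Ω (g i) = push g i (q i)) {W : Type} {s s' : W → S.Node} {l : W → W → S.σ}
    (hs : ∀ x, (s' x).1 = (s x).1 ∧ (∀ i < m, (s' x).2 (g i) = (s x).2 i) ∧
      ∀ z < ℓ, (s' x).2 z ≠ S.zero → ∃ i, i < m ∧ g i = z)
    (h : OK q m s l) : OK Ω ℓ s' l := by
  have hinj : ∀ k, k ≤ m → ∀ i < k, ∀ j < k, g i = g j → i = j := by
    intro k hk i hi j hj hij
    rcases lt_trichotomy i j with h1 | h1 | h1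
    · exact absurd (hmono i (by omega) j (by omega) h1) (by omega)
    · exact h1
    · exact absurd (hmono j (by omega) i (by omega) h1) (by omega)
  intro n f f1 f2 f3
  by_cases hex : ∃ a x, f a = Sum.inr x
  · obtain ⟨a, x, ha⟩ := hex
    have hf : ∀ b, ∃ y : ℕ ⊕ W, f b = Sum.map g id y ∧ ∀ i, y = Sum.inl i → i < m := by
      intro b
      rcases hb : f b with z | y
      · have hba : b ≠ a := by
          rintro rfl
          rw [ha] at hb; cases hb
        have h2 := f2 b a hba
        rw [ha, hb] at h2
        obtain ⟨i, hi, hiz⟩ := (hs x).2.2 z (f1 b z hb) h2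
        exact ⟨Sum.inl i, by simp [hiz], fun j hj => by cases hj; exact hi⟩
      · exact ⟨Sum.inr y, rfl, fun i hi => by cases hi⟩
    choose y hy hym using hf
    have hlab : ∀ b c, lab Ω s' l (f b) (f c) = lab q s l (y b) (y c) := by
      intro b c
      rw [hy b, hy c]
      rcases hb : y b with i | x <;> rcases hc : y c with j | x'
      · have hi := hym b i hb
        have hj := hym c j hc
        rcases lt_trichotomy i j with hij | rfl | hij
        · have h1 := hmono i hi j hj hij
          simp only [lab, Sum.map_inl, h1, if_true, hij]
          rw [hg j hj, push_apply _ (hinj j hj.le) hij]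
        · simp [lab]
        · have h1 := hmono j hj i hi hij
          simp only [lab, Sum.map_inl, h1, if_true, hij, not_lt.2 hij.le, not_lt.2 h1.le, if_false]
          rw [hg i hi, push_apply _ (hinj i hi.le) hij]
      · exact (hs x').2.1 i (hym b i hb)
      · exact congrArg S.sw ((hs x).2.1 j (hym c j hc))
      · rfl
    have hun : ∀ b, un Ω s' (f b) = un q s (y b) := by
      intro b
      rw [hy b]
      rcases hb : y b with i | x
      · simp only [un, Sum.map_inl]
        rw [hg i (hym b i hb)]; rfl
      · exact (hs x).1
    refine h n y (fun b i hb => hym b i hb) (fun b c hbc => ?_) ?_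
    · rw [← hlab]; exact f2 b c hbc
    · simp only [hlab, hun] at f3; exact f3
  · have hf : ∀ a, ∃ i, f a = Sum.inl i := by
      intro a
      rcases ha : f a with i | x
      · exact ⟨i, rfl⟩
      · exact (hex ⟨a, x, ha⟩).elim
    choose g hg using hf
    refine hΩ ℓ n (fun a => Sum.inl (g a)) (fun a i hi => f1 a i ((hg a).trans (by simpa using hi)))
      (fun a b hab => ?_) ?_
    · have := f2 a b hab
      rw [hg a, hg b] at this; exact this
    · simp only [hg] at f3; exact f3

theorem Free.okp {q : ℕ → S.Node} (h : Free q) (j : ℕ) : OKp q j (q j) := by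
  have h1 := OK_code.1 (h (j + 1))
  exact h1.reindex (fun _ : Unit => none)

theorem exists_semb {Ω q : ℕ → S.Node} (hΩ : Gen Ω) (hq : Free q) :
    ∃ g, SEmb Set.univ q Ω g := by
  obtain ⟨g, hg⟩ := BR_exists_seq (α := ℕ) (fun m g a => (∀ i < m, g i < a) ∧ Ω a = push g m (q m)) (by
    rintro m g g' a hgg ⟨h1, h2⟩
    exact ⟨fun i hi => by rw [← hgg i hi]; exact h1 i hi, by rw [h2]; exact push_congr _ hgg⟩) (by
    intro m g hg
    obtain ⟨ℓ, hℓ⟩ : ∃ ℓ, ∀ i < m, g i < ℓ := by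
      refine ⟨(Finset.range m).sup g + 1, fun i hi => Nat.lt_succ_of_le ?_⟩
      exact Finset.le_sup (f := g) (Finset.mem_range.2 hi)
    have hmono : ∀ i < m, ∀ j < m, i < j → g i < g j := fun i _ j hj hij => (hg j hj).1 i hij
    have hinj : ∀ i < m, ∀ j < m, g i = g j → i = j := by
      intro i hi j hj hij
      rcases lt_trichotomy i j with h1 | h1 | h1
      · exact absurd (hmono i (by omega) j (by omega) h1) (by omega)
      · exact h1
      · exact absurd (hmono j (by omega) i (by omega) h1) (by omega)
    obtain ⟨j, hj, hjΩ⟩ := hΩ.gen ℓ (push g m (q m)) (by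
      intro z hz
      by_contra hcon
      obtain ⟨i, hi, rfl⟩ := push_zero _ hcon
      have := hℓ i hi; omega) (by
      exact push_ok hΩ.free hmono (fun i hi => (hg i hi).2)
        (s := fun _ => q m) (fun x => ⟨rfl, fun i hi => push_apply _ hinj hi, fun z _ hz => push_zero _ hz⟩)
        (hq.okp m))
    exact ⟨j, fun i hi => (hℓ i hi).trans_le hj, hjΩ⟩)
  have hmono : ∀ i j, i < j → g i < g j := fun i j hij => (hg j).1 i hij
  have hinj : ∀ i j, g i = g j → i = j := fun i j hij =>
    (strictMono_nat_of_lt_succ (fun n => hmono n (n + 1) (Nat.lt_succ_self n))).injective hij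
  have happ : ∀ j i, i < j → (Ω (g j)).2 (g i) = (q j).2 i := by
    intro j i hij
    rw [(hg j).2, push_apply _ (fun i _ j _ => hinj i j) hij]
  have hz : ∀ j k z, z < g k → (Ω (g j)).2 z ≠ S.zero → ∃ i, i < k ∧ g i = z := by
    intro j k z hzk hz
    rw [(hg j).2] at hz
    obtain ⟨i, _, rfl⟩ := push_zero _ hz
    refine ⟨i, ?_, rfl⟩
    by_contra hcon
    rcases (not_lt.1 hcon).eq_or_lt with rfl | h1
    · omega
    · have := hmono _ _ h1; omega
  have hun : ∀ j, (Ω (g j)).1 = (q j).1 := fun j => by rw [(hg j).2]; rfl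
  refine ⟨g, fun i _ j _ hij => hmono i j hij, fun i _ => hun i, fun i _ j _ hij => happ j i hij, ?_, ?_⟩
  · intro k _ i _ j _ hki hkj ha
    refine ⟨by rw [hun, hun]; exact ha.1, fun z hzk => ?_⟩
    by_cases hex : ∃ i', i' < k ∧ g i' = z
    · obtain ⟨i', hi', rfl⟩ := hex
      rw [happ _ _ (by omega), happ _ _ (by omega)]
      exact ha.2 i' hi'
    · have h1 : ∀ j, (Ω (g j)).2 z = S.zero := fun j => by
        by_contra hcon
        exact hex (hz j k z hzk hcon)
      rw [h1, h1]
  · intro k _ W _ w hw l h0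
    refine push_ok hΩ.free (m := k) (fun i _ j _ hij => hmono i j hij) (fun i _ => (hg i).2)
      (fun x => ⟨hun _, fun i hi => happ _ _ (hi.trans_le (hw x).2), fun z hzk hzz => hz _ k z hzk hzz⟩) h0

end BRSys

end Part6

section Part7

theorem BR_enum (M : ℕ) : ∃ (β : ℕ → Fin M → ℕ) (π ρ : ℕ → ℕ),
    (∀ c b, (∀ i, b i ≤ π c) → ∃ c', c' ≤ c ∧ β c' = b) ∧ (∀ i j, i < j → ρ i < ρ j) ∧ ∀ r, π (ρ r) = r := by
  classical
  obtain ⟨ν, hν⟩ := exists_surjective_nat (Fin M → ℕ)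
  let β : ℕ → Fin M → ℕ := fun c => if c = 0 then 0 else ν (c - 1)
  have hβ : ∀ b, ∃ c, β c = b := fun b => by
    obtain ⟨a, ha⟩ := hν b
    exact ⟨a + 1, by simp [β, ha]⟩
  choose inv hinv using hβ
  let Good : ℕ → ℕ → Prop := fun c r => ∀ b, (∀ i, b i ≤ r) → ∃ c', c' ≤ c ∧ β c' = b
  let π : ℕ → ℕ := fun c => if Good c (Nat.unpair c).1 then (Nat.unpair c).1 else 0
  have h1 : ∀ c, Good c (π c) := by
    intro c
    by_cases h : Good c (Nat.unpair c).1
    · simp only [π, if_pos h]; exact h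
    · simp only [π, if_neg h]
      intro b hb
      refine ⟨0, Nat.zero_le _, ?_⟩
      funext i
      have := hb i
      simp [β]; omega
  have h2 : ∀ r c0, ∃ c, c0 ≤ c ∧ π c = r := by
    intro r c0
    have hfin : (Set.Iic (fun _ : Fin M => r)).Finite := Set.finite_Iic _
    obtain ⟨c1, hc1⟩ := (hfin.image inv).bddAbove
    refine ⟨Nat.pair r (c0 + c1), (Nat.le_add_right _ _).trans (Nat.right_le_pair _ _), ?_⟩
    have hg : Good (Nat.pair r (c0 + c1)) (Nat.unpair (Nat.pair r (c0 + c1))).1 := by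
      rw [Nat.unpair_pair]
      intro b hb
      refine ⟨inv b, ?_, hinv b⟩
      have h3 : inv b ≤ c1 := hc1 ⟨b, hb, rfl⟩
      exact (h3.trans (Nat.le_add_left _ _)).trans (Nat.right_le_pair _ _)
    simp only [π, if_pos hg, Nat.unpair_pair]
  obtain ⟨ρ, hρ⟩ := BR_exists_seq (α := ℕ) (fun m g a => (∀ i < m, g i < a) ∧ π a = m) (by
    rintro m g g' a hgg ⟨h1, h2⟩
    exact ⟨fun i hi => by rw [← hgg i hi]; exact h1 i hi, h2⟩) (by
    intro m g _
    obtain ⟨c, hc, hc2⟩ := h2 m ((Finset.range m).sup g + 1)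
    refine ⟨c, fun i hi => ?_, hc2⟩
    have : g i ≤ _ := Finset.le_sup (f := g) (Finset.mem_range.2 hi)
    omega)
  exact ⟨β, π, ρ, h1, fun i j hij => (hρ j).1 i hij, fun r => (hρ r).2⟩

namespace BRSys

variable {S : BRSys}

/-- closed finite sets of levels -/
structure Cl (q : ℕ → S.Node) (T : Finset ℕ) : Prop where
  c1 : ∀ k ∈ T, ∀ i ∈ T, ∀ j ∈ T, k ≤ i → k ≤ j → (∀ z ∈ T, z < k → (q i).2 z = (q j).2 z) →
    ∀ z < k, (q i).2 z = (q j).2 z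
  c2 : ∀ k ∈ T, ∀ (W : Type) (w : W → ℕ), (∀ x, w x ∈ T ∧ k ≤ w x) → ∀ l : W → W → S.σ,
    (∀ (n : ℕ) (f : Fin n → ℕ ⊕ W), (∀ a i, f a = Sum.inl i → i < k ∧ i ∈ T) →
      (∀ a b, a ≠ b → lab q (fun x => q (w x)) l (f a) (f b) ≠ S.zero) →
      ¬ S.Bad n (fun a => BRSys.un q (fun x => q (w x)) (f a))
        (fun a b => lab q (fun x => q (w x)) l (f a) (f b))) →
    OK q k (fun x => q (w x)) l

theorem Cl.induced {q : ℕ → S.Node} {T : Finset ℕ} (h : Cl q T) :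
    ∃ (g : ℕ → ℕ) (P : ℕ → S.Node), (∀ i, Nrm i (P i)) ∧ SEmb (Set.Iio T.card) P q g ∧
      ∀ z ∈ T, ∃ i, i < T.card ∧ g i = z := by
  classical
  let o := T.orderEmbOfFin rfl
  let g : ℕ → ℕ := fun i => if hi : i < T.card then o ⟨i, hi⟩ else 0
  have hg : ∀ i (hi : i < T.card), g i = o ⟨i, hi⟩ := fun i hi => by simp [g, hi]
  have hgT : ∀ i, i < T.card → g i ∈ T := fun i hi => by
    rw [hg i hi]; exact T.orderEmbOfFin_mem rfl _
  have hmono : ∀ i j, i < T.card → j < T.card → i < j → g i < g j := by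
    intro i j hi hj hij
    rw [hg i hi, hg j hj]
    exact o.strictMono (by simpa using hij)
  have hsurj : ∀ z ∈ T, ∃ i, i < T.card ∧ g i = z := by
    intro z hz
    have : z ∈ Set.range o := by rw [Finset.range_orderEmbOfFin]; exact hz
    obtain ⟨i, hi⟩ := this
    exact ⟨i, i.2, by rw [hg i i.2]; exact hi⟩
  have hlt : ∀ i j, i < T.card → j < T.card → g i < g j → i < j := by
    intro i j hi hj hij
    by_contra hcon
    rcases (not_lt.1 hcon).eq_or_lt with rfl | h1
    · omega
    · have := hmono _ _ hj hi h1; omega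
  let P : ℕ → S.Node := fun i => ((q (g i)).1, fun j => if j < i then (q (g i)).2 (g j) else S.zero)
  have hP : ∀ i j, j < i → (P i).2 j = (q (g i)).2 (g j) := fun i j hij => by simp [P, hij]
  have hle : ∀ i j, i < T.card → j < T.card → i ≤ j → g i ≤ g j := by
    intro i j hi hj hij
    rcases hij.eq_or_lt with rfl | h1
    · exact le_rfl
    · exact (hmono _ _ hi hj h1).le
  refine ⟨g, P, fun i j hj => by simp [P, not_lt.2 hj], ⟨?_, ?_, ?_, ?_, ?_⟩, hsurj⟩
  · intro i hi j hj hij; exact hmono i j hi hj hij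
  · intro i _; rfl
  · intro i _ j _ hij; exact (hP j i hij).symm
  · intro k hk i hi j hj hki hkj ha
    refine ⟨ha.1, h.c1 _ (hgT k hk) _ (hgT i hi) _ (hgT j hj) (hle _ _ hk hi hki) (hle _ _ hk hj hkj) ?_⟩
    intro z hz hzk
    obtain ⟨a, haT, rfl⟩ := hsurj z hz
    have hak := hlt _ _ haT hk hzk
    rw [← hP i a (by omega), ← hP j a (by omega)]
    exact ha.2 a hak
  · intro k hk W _ w hw l h0
    refine h.c2 _ (hgT k hk) W (fun x => g (w x)) (fun x => ⟨hgT _ (hw x).1, hle _ _ hk (hw x).1 (hw x).2⟩) l ?_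
    intro n f f1 f2 f3
    have hf : ∀ a, ∃ y : ℕ ⊕ W, f a = Sum.map g id y ∧ ∀ i, y = Sum.inl i → i < k := by
      intro a
      rcases ha : f a with z | x
      · obtain ⟨h1, h2⟩ := f1 a z ha
        obtain ⟨i, hi, rfl⟩ := hsurj z h2
        exact ⟨Sum.inl i, rfl, fun j hj => by cases hj; exact hlt _ _ hi hk h1⟩
      · exact ⟨Sum.inr x, rfl, fun j hj => by cases hj⟩
    choose y hy hyk using hf
    have hk' : k < T.card := hk
    have hlab : ∀ a b, BRSys.lab q (fun x => q (g (w x))) l (f a) (f b) =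
        BRSys.lab P (fun x => P (w x)) l (y a) (y b) := by
      intro a b
      rw [hy a, hy b]
      rcases ha : y a with i | x <;> rcases hb : y b with j | x'
      · have hi := hyk a i ha
        have hj := hyk b j hb
        rcases lt_trichotomy i j with hij | rfl | hij
        · have h1 := hmono i j (by omega) (by omega) hij
          simp only [BRSys.lab, Sum.map_inl, h1, if_true, hij]
          rw [hP j i hij]
        · simp [BRSys.lab]
        · have h1 := hmono j i (by omega) (by omega) hij
          simp only [BRSys.lab, Sum.map_inl, h1, if_true, hij, not_lt.2 hij.le, not_lt.2 h1.le, if_false]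
          rw [hP i j hij]
      · exact (hP _ _ ((hyk a i ha).trans_le (hw x').2)).symm
      · exact congrArg S.sw (hP _ _ ((hyk b j hb).trans_le (hw x).2)).symm
      · rfl
    have hun : ∀ a, BRSys.un q (fun x => q (g (w x))) (f a) = BRSys.un P (fun x => P (w x)) (y a) := by
      intro a
      rw [hy a]
      rcases y a with i | x <;> rfl
    refine h0 n y hyk (fun a b hab => ?_) ?_
    · rw [← hlab]; exact f2 a b hab
    · simp only [hlab, hun] at f3; exact f3

/-- data of a countable free structure -/
structure UDat (S : BRSys) where
  un0 : ℕ → S.υ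
  u : ℕ → ℕ → S.σ
  diag : ∀ a, u a a = S.zero
  hsw : ∀ a b, u b a = S.sw (u a b)
  free : ∀ (n : ℕ) (f : Fin n → ℕ), (∀ a b, a ≠ b → u (f a) (f b) ≠ S.zero) →
    ¬ S.Bad n (fun a => un0 (f a)) (fun a b => u (f a) (f b))

/-- the expanded sequence -/
structure UExp (S : BRSys) extends UDat S where
  β : ℕ → Fin (S.K + 1) → ℕ
  π : ℕ → ℕ
  ρ : ℕ → ℕ
  hβ : ∀ c b, (∀ i, b i ≤ π c) → ∃ c', c' ≤ c ∧ β c' = b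
  ρm : ∀ i j, i < j → ρ i < ρ j
  hρ : ∀ r, π (ρ r) = r

namespace UExp

variable (E : UExp S)

/-- cell of a level -/
def cell (_ : UExp S) (z : ℕ) : ℕ := z / (S.K + 2)
/-- position in the cell -/
def pos (_ : UExp S) (z : ℕ) : ℕ := z % (S.K + 2)
/-- level of a ghost or real -/
def lev (_ : UExp S) (c i : ℕ) : ℕ := c * (S.K + 2) + i

theorem cell_lev {c i : ℕ} (hi : i ≤ S.K + 1) : E.cell (E.lev c i) = c := by
  unfold cell lev
  rw [mul_comm, Nat.mul_add_div (by omega), Nat.div_eq_of_lt (by omega), add_zero]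

theorem pos_lev {c i : ℕ} (hi : i ≤ S.K + 1) : E.pos (E.lev c i) = i := by
  unfold pos lev
  rw [mul_comm, Nat.mul_add_mod, Nat.mod_eq_of_lt (by omega)]

theorem lev_eq (z : ℕ) : E.lev (E.cell z) (E.pos z) = z := by
  unfold cell pos lev
  rw [mul_comm]; exact Nat.div_add_mod _ _

theorem pos_le (z : ℕ) : E.pos z ≤ S.K + 1 := by
  unfold pos
  have := Nat.mod_lt z (show 0 < S.K + 2 by omega)
  omega

theorem lev_lt {c i c' i' : ℕ} (hi : i ≤ S.K + 1) (h : c < c') : E.lev c i < E.lev c' i' := by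
  unfold lev
  have : (c + 1) * (S.K + 2) ≤ c' * (S.K + 2) := Nat.mul_le_mul_right _ h
  have h2 : (c + 1) * (S.K + 2) = c * (S.K + 2) + (S.K + 2) := by ring
  omega

theorem lev_lt' {c i i' : ℕ} (h : i < i') : E.lev c i < E.lev c i' := by
  unfold lev; omega

theorem cell_mono {z z' : ℕ} (h : z ≤ z') : E.cell z ≤ E.cell z' := Nat.div_le_div_right h

theorem pos_lt_of {z z' : ℕ} (h : z < z') (hc : E.cell z = E.cell z') : E.pos z < E.pos z' := by
  rw [← E.lev_eq z, ← E.lev_eq z', hc] at h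
  unfold lev at h; omega

/-- original vertex -/
def orig (z : ℕ) : ℕ := if h : E.pos z < S.K + 1 then E.β (E.cell z) ⟨E.pos z, h⟩ else E.π (E.cell z)

theorem orig_lev (c : ℕ) (i : Fin (S.K + 1)) : E.orig (E.lev c i) = E.β c i := by
  have hi : (i : ℕ) ≤ S.K + 1 := i.2.le
  simp only [orig, E.cell_lev hi, E.pos_lev hi, dif_pos i.2]

/-- cut-off label -/
def γ (y r : ℕ) : S.σ := if y < r then E.u y r else S.zero

/-- the sequence -/
def q (z : ℕ) : S.Node := (E.un0 (E.orig z), fun z' => if z' < z then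
    (if E.pos z < S.K + 1 then (if E.cell z' = E.cell z then E.u (E.orig z') (E.orig z) else S.zero)
      else E.γ (E.orig z') (E.orig z)) else S.zero)

theorem q_ghost {z z' : ℕ} (hz : E.pos z < S.K + 1) (h : z' < z) :
    (E.q z).2 z' = if E.cell z' = E.cell z then E.u (E.orig z') (E.orig z) else S.zero := by
  simp [q, h, hz]

theorem q_real {z z' : ℕ} (hz : ¬ E.pos z < S.K + 1) (h : z' < z) :
    (E.q z).2 z' = E.γ (E.orig z') (E.orig z) := by
  simp [q, h, hz]

theorem q_nz {z z' : ℕ} (h : z' < z) (h0 : (E.q z).2 z' ≠ S.zero) :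
    (E.q z).2 z' = E.u (E.orig z') (E.orig z) := by
  by_cases hz : E.pos z < S.K + 1
  · rw [E.q_ghost hz h] at h0 ⊢
    by_cases hc : E.cell z' = E.cell z
    · rw [if_pos hc]
    · rw [if_neg hc] at h0; exact (h0 rfl).elim
  · rw [E.q_real hz h] at h0 ⊢
    unfold γ at h0 ⊢
    by_cases hc : E.orig z' < E.orig z
    · rw [if_pos hc]
    · rw [if_neg hc] at h0; exact (h0 rfl).elim

theorem lab_inl {W : Type} (s : W → S.Node) (l : W → W → S.σ) {z z' : ℕ}
    (h : z = z' ∨ lab E.q s l (Sum.inl z) (Sum.inl z') ≠ S.zero) :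
    lab E.q s l (Sum.inl z) (Sum.inl z') = E.u (E.orig z) (E.orig z') := by
  rcases lt_trichotomy z z' with hz | rfl | hz
  · simp only [lab, hz, if_true] at h ⊢
    rcases h with h | h
    · omega
    · exact E.q_nz hz h
  · simp [lab, E.diag]
  · simp only [lab, hz, if_true, not_lt.2 hz.le, if_false] at h ⊢
    rcases h with h | h
    · omega
    · rw [E.q_nz hz ?_, ← E.hsw]
      intro h1
      rw [h1, S.sw_zero] at h
      exact h rfl

theorem free_q : Free E.q := by
  intro ℓ n f _ f2 f3
  have hf : ∀ a, ∃ z, f a = Sum.inl z := by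
    intro a
    rcases f a with z | x
    · exact ⟨z, rfl⟩
    · exact x.elim
  choose z hz using hf
  have hlab : ∀ a b, lab E.q (fun x : Empty => x.elim) (fun x _ => x.elim) (f a) (f b) =
      E.u (E.orig (z a)) (E.orig (z b)) := by
    intro a b
    by_cases hab : a = b
    · subst hab
      rw [hz]; exact E.lab_inl _ _ (Or.inl rfl)
    · have := f2 a b hab
      rw [hz, hz] at this ⊢
      exact E.lab_inl _ _ (Or.inr this)
  refine E.free n (fun a => E.orig (z a)) (fun a b hab => ?_) ?_
  · rw [← hlab]; exact f2 a b hab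
  · simp only [hlab] at f3; simp only [hz] at f3; exact f3

/-- level of the real copy of a vertex -/
def R (r : ℕ) : ℕ := E.lev (E.ρ r) (S.K + 1)

theorem pos_R (r : ℕ) : E.pos (E.R r) = S.K + 1 := E.pos_lev le_rfl

theorem orig_R (r : ℕ) : E.orig (E.R r) = r := by
  have h : ¬ E.pos (E.R r) < S.K + 1 := by rw [E.pos_R]; omega
  simp only [orig, dif_neg h]
  unfold R
  rw [E.cell_lev le_rfl, E.hρ]

theorem R_lt {r r' : ℕ} (h : r < r') : E.R r < E.R r' := E.lev_lt le_rfl (E.ρm _ _ h)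

theorem q_R {r z : ℕ} (h : z < E.R r) : (E.q (E.R r)).2 z = E.γ (E.orig z) r := by
  rw [E.q_real (by rw [E.pos_R]; omega) h, E.orig_R]

theorem q_R_R {r r' : ℕ} (h : r < r') : (E.q (E.R r')).2 (E.R r) = E.u r r' := by
  rw [E.q_R (E.R_lt h), E.orig_R]; simp [γ, h]

theorem q_R_un (r : ℕ) : (E.q (E.R r)).1 = E.un0 r := by
  simp [q, E.orig_R]

end UExp

theorem UDat.exists_exp (D : UDat S) : ∃ E : UExp S, E.toUDat = D := by
  obtain ⟨β, π, ρ, h1, h2, h3⟩ := BR_enum (S.K + 1)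
  exact ⟨{ D with β := β, π := π, ρ := ρ, hβ := h1, ρm := h2, hρ := h3 }, rfl⟩

end BRSys

end Part7

section Part8

namespace BRSys

variable {S : BRSys}

namespace UExp

variable (E : UExp S)

/-- events -/
abbrev Ev (S : BRSys) (A : Type) : Type :=
  (n : Fin (S.K + 1)) × ((Fin n → Option A) × (Fin n → Fin n → S.σ))

/-- labels of an event -/
def evL {A : Type} (e : A → ℕ) {n : ℕ} (p : Fin n → Option A) (l : Fin n → Fin n → S.σ)
    (y : Fin n → ℕ) (a b : Fin n) : S.σ :=
  match p a, p b with
  | none, none => E.u (y a) (y b)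
  | none, some x => E.γ (y a) (e x)
  | some x, none => S.sw (E.γ (y b) (e x))
  | some _, some _ => l a b

/-- unary types of an event -/
def evU {A : Type} (e : A → ℕ) {n : ℕ} (p : Fin n → Option A) (y : Fin n → ℕ) (a : Fin n) : S.υ :=
  match p a with
  | none => E.un0 (y a)
  | some x => E.un0 (e x)

/-- killing -/
def Kill {A : Type} (e : A → ℕ) {n : ℕ} (p : Fin n → Option A) (l : Fin n → Fin n → S.σ)
    (y : Fin n → ℕ) : Prop :=
  (∀ a b, a ≠ b → E.evL e p l y a b ≠ S.zero) ∧ S.Bad n (E.evU e p y) (E.evL e p l y)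

/-- label towards an optional real -/
def γo {A : Type} (e : A → ℕ) (y : ℕ) : Option A → S.σ
  | none => S.zero
  | some a => E.γ y (e a)

/-- indices of chosen cells -/
abbrev Ix (S : BRSys) (A : Type) : Type := (Option A × Option A) ⊕ Ev S A

/-- goodness of a cell for an index -/
def CP {A : Type} (e : A → ℕ) : Ix S A → ℕ → Prop
  | Sum.inl p, c => ∃ h : Fin (S.K + 1), E.γo e (E.β c h) p.1 ≠ E.γo e (E.β c h) p.2
  | Sum.inr ev, c => ∃ h : Fin ev.1 → Fin (S.K + 1), E.Kill e ev.2.1 ev.2.2 (fun a => E.β c (h a))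

/-- chosen cell -/
noncomputable def κ {A : Type} (e : A → ℕ) (j : Ix S A) : ℕ := sInf {c | E.CP e j c}

theorem κ_spec {A : Type} (e : A → ℕ) (j : Ix S A) {c : ℕ} (h : E.CP e j c) : E.CP e j (E.κ e j) ∧ E.κ e j ≤ c :=
  ⟨Nat.sInf_mem (s := {c | E.CP e j c}) ⟨c, h⟩, Nat.sInf_le (s := {c | E.CP e j c}) h⟩

theorem closure (A : Type) [Finite A] : ∃ N, ∀ e : A → ℕ, ∃ T : Finset ℕ, T.card ≤ N ∧
    (∀ a, E.R (e a) ∈ T) ∧ Cl E.q T := by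
  classical
  have := Fintype.ofFinite A
  have : Finite (Ix S A) := inferInstance
  have := Fintype.ofFinite (Ix S A)
  refine ⟨Fintype.card (A ⊕ Ix S A × Fin (S.K + 1)), fun e => ?_⟩
  let F : A ⊕ Ix S A × Fin (S.K + 1) → ℕ := Sum.elim (fun a => E.R (e a)) (fun p => E.lev (E.κ e p.1) p.2)
  let T : Finset ℕ := Finset.univ.image F
  have T0 : ∀ a, E.R (e a) ∈ T := fun a => Finset.mem_image.2 ⟨Sum.inl a, Finset.mem_univ _, rfl⟩
  have T1 : ∀ z ∈ T, (∃ a, z = E.R (e a)) ∨ (E.pos z < S.K + 1 ∧ ∃ j, E.cell z = E.κ e j) := by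
    intro z hz
    obtain ⟨x, _, rfl⟩ := Finset.mem_image.1 hz
    rcases x with a | ⟨j, i⟩
    · exact Or.inl ⟨a, rfl⟩
    · refine Or.inr ⟨?_, j, E.cell_lev i.2.le⟩
      change E.pos (E.lev _ _) < _
      rw [E.pos_lev i.2.le]; exact i.2
  have T2 : ∀ z j, E.cell z = E.κ e j → E.pos z < S.K + 1 → z ∈ T := by
    intro z j hc hp
    refine Finset.mem_image.2 ⟨Sum.inr (j, ⟨E.pos z, hp⟩), Finset.mem_univ _, ?_⟩
    change E.lev (E.κ e j) (E.pos z) = z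
    rw [← hc]; exact E.lev_eq z
  have T2' : ∀ j (h : Fin (S.K + 1)), E.lev (E.κ e j) h ∈ T := fun j h =>
    Finset.mem_image.2 ⟨Sum.inr (j, h), Finset.mem_univ _, rfl⟩
  have T3 : ∀ m ∈ T, E.pos m < S.K + 1 → ∀ z, z < m → E.cell z = E.cell m → z ∈ T := by
    intro m hm hp z hz hc
    rcases T1 m hm with ⟨a, rfl⟩ | ⟨_, j, hj⟩
    · rw [E.pos_R] at hp; omega
    · exact T2 z j (hc.trans hj) ((E.pos_lt_of hz hc).trans hp)
  refine ⟨T, Finset.card_image_le, T0, ?_, ?_⟩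
  · intro k hk i hi j hj hki hkj hagr z hzk
    by_contra hne
    have hzT : z ∉ T := fun h => hne (hagr z h hzk)
    have hval : ∀ m ∈ T, k ≤ m → ∃ o : Option A, ∀ z0, z0 ≤ z → (E.q m).2 z0 = E.γo e (E.orig z0) o := by
      intro m hm hkm
      rcases T1 m hm with ⟨a, rfl⟩ | ⟨hp, _⟩
      · exact ⟨some a, fun z0 hz0 => E.q_R (by omega)⟩
      · refine ⟨none, fun z0 hz0 => ?_⟩
        rw [E.q_ghost hp (by omega), if_neg]
        · rfl
        · intro hc
          refine hzT (T3 m hm hp z (by omega) ?_)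
          have h1 := E.cell_mono hz0
          have h2 := E.cell_mono (show z ≤ m by omega)
          omega
    obtain ⟨a, ha⟩ := hval i hi hki
    obtain ⟨b, hb⟩ := hval j hj hkj
    rw [ha z le_rfl, hb z le_rfl] at hne
    obtain ⟨c1, h1, hz1, ho⟩ : ∃ (c1 : ℕ) (h1 : Fin (S.K + 1)), E.lev c1 h1 ≤ z ∧ E.β c1 h1 = E.orig z := by
      by_cases hp : E.pos z < S.K + 1
      · refine ⟨E.cell z, ⟨E.pos z, hp⟩, (E.lev_eq z).le, ?_⟩
        simp [orig, hp]
      · obtain ⟨c, hc, hcb⟩ := E.hβ (E.cell z) (fun _ => E.π (E.cell z)) (fun _ => le_rfl)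
        refine ⟨c, 0, ?_, ?_⟩
        · have h1 : E.lev (E.cell z) 0 ≤ z := by
            conv_rhs => rw [← E.lev_eq z]
            unfold lev; omega
          refine le_trans ?_ h1
          rcases hc.eq_or_lt with rfl | hc
          · exact le_rfl
          · exact (E.lev_lt (by simp) hc).le
        · rw [hcb]; simp [orig, hp]
    have hCP : E.CP e (Sum.inl (a, b)) c1 := ⟨h1, by rw [ho]; exact hne⟩
    obtain ⟨⟨h0, hh0⟩, hle⟩ := E.κ_spec e _ hCP
    obtain ⟨z0, hz0, hz0T, hz0n⟩ : ∃ z0, z0 ≤ z ∧ z0 ∈ T ∧ E.γo e (E.orig z0) a ≠ E.γo e (E.orig z0) b := by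
      rcases hle.eq_or_lt with heq | hlt
      · refine ⟨E.lev c1 h1, hz1, ?_, ?_⟩
        · rw [← heq]; exact T2' _ _
        · rw [E.orig_lev, ho]; exact hne
      · refine ⟨E.lev (E.κ e (Sum.inl (a, b))) h0, ?_, T2' _ _, ?_⟩
        · exact ((E.lev_lt h0.2.le hlt).le).trans hz1
        · rw [E.orig_lev]; exact hh0
    exact hz0n (by rw [← ha z0 hz0, ← hb z0 hz0]; exact hagr z0 hz0T (by omega))
  · intro k hk W w hw l hyp n f f1 f2 f3
    set s : W → S.Node := fun x => E.q (w x) with hs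
    -- case a
    by_cases hA : ∃ a x, f a = Sum.inr x ∧ E.pos (w x) < S.K + 1
    · obtain ⟨a, x, hax, hp⟩ := hA
      refine hyp n f (fun b z hb => ⟨f1 b z hb, ?_⟩) f2 f3
      have hzk := f1 b z hb
      have hba : b ≠ a := by
        rintro rfl
        rw [hax] at hb; cases hb
      have h2 := f2 b a hba
      rw [hb, hax] at h2
      change (E.q (w x)).2 z ≠ S.zero at h2
      have hzw : z < w x := hzk.trans_le (hw x).2
      rw [E.q_ghost hp hzw] at h2
      refine T3 (w x) (hw x).1 hp z hzw ?_
      by_contra hc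
      rw [if_neg hc] at h2; exact h2 rfl
    have hreal : ∀ a x, f a = Sum.inr x → ∃ i, w x = E.R (e i) := by
      intro a x hax
      rcases T1 (w x) (hw x).1 with h | h
      · exact h
      · exact (hA ⟨a, x, hax, h.1⟩).elim
    -- no level at all
    by_cases hB : ∀ a z, f a ≠ Sum.inl z
    · exact hyp n f (fun b z hb => (hB b z hb).elim) f2 f3
    push Not at hB
    obtain ⟨ai, zi, hai⟩ := hB
    have hnK : n ≤ S.K := S.bad_le n _ _ f3
    have hex : ∀ a, ∃ (o : Option A), (o = none ↔ ∃ z, f a = Sum.inl z) ∧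
        ∀ i, o = some i → ∃ x, f a = Sum.inr x ∧ w x = E.R (e i) := by
      intro a
      rcases hfa : f a with z | x
      · exact ⟨none, by simp, by simp⟩
      · obtain ⟨i, hi⟩ := hreal a x hfa
        exact ⟨some i, by simp, fun j hj => ⟨x, rfl, by cases hj; exact hi⟩⟩
    choose p hp1 hp2 using hex
    let l' : Fin n → Fin n → S.σ := fun a b => lab E.q s l (f a) (f b)
    have hgen : ∀ (f' : Fin n → ℕ ⊕ W) (y : Fin n → ℕ),
        (∀ a x, f a = Sum.inr x → f' a = Sum.inr x) →
        (∀ a, p a = none → ∃ z, f' a = Sum.inl z ∧ z < k ∧ E.orig z = y a) →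
        (∀ a b z z', f' a = Sum.inl z → f' b = Sum.inl z' →
          lab E.q s l (Sum.inl z) (Sum.inl z') = E.u (E.orig z) (E.orig z')) →
        (∀ a b, lab E.q s l (f' a) (f' b) = E.evL e p l' y a b) ∧
          ∀ a, un E.q s (f' a) = E.evU e p y a := by
      intro f' y hf1 hf2 hf3
      constructor
      · intro a b
        rcases ha : p a with _ | i <;> rcases hb : p b with _ | j
        · obtain ⟨z, hz, hzk, hy⟩ := hf2 a ha
          obtain ⟨z', hz', hzk', hy'⟩ := hf2 b hb
          have := hf3 a b z z' hz hz'
          simp only [evL, ha, hb]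
          rw [hz, hz', this, hy, hy']
        · obtain ⟨z, hz, hzk, hy⟩ := hf2 a ha
          obtain ⟨x, hx, hwx⟩ := hp2 b j hb
          simp only [evL, ha, hb]
          rw [hz, hf1 b x hx]
          change (E.q (w x)).2 z = _
          have h1 := (hw x).2
          rw [hwx] at h1 ⊢
          rw [E.q_R (by omega), hy]
        · obtain ⟨z, hz, hzk, hy⟩ := hf2 b hb
          obtain ⟨x, hx, hwx⟩ := hp2 a i ha
          simp only [evL, ha, hb]
          rw [hz, hf1 a x hx]
          change S.sw ((E.q (w x)).2 z) = _
          have h1 := (hw x).2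
          rw [hwx] at h1 ⊢
          rw [E.q_R (by omega), hy]
        · obtain ⟨x, hx, hwx⟩ := hp2 a i ha
          obtain ⟨x', hx', hwx'⟩ := hp2 b j hb
          simp only [evL, ha, hb, l']
          rw [hf1 a x hx, hf1 b x' hx', hx, hx']
      · intro a
        rcases ha : p a with _ | i
        · obtain ⟨z, hz, hzk, hy⟩ := hf2 a ha
          simp only [evU, ha]
          rw [hz, ← hy]; rfl
        · obtain ⟨x, hx, hwx⟩ := hp2 a i ha
          simp only [evU, ha]
          rw [hf1 a x hx]
          change (E.q (w x)).1 = _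
          rw [hwx, E.q_R_un]
    have hlab0 : ∀ a b z z', f a = Sum.inl z → f b = Sum.inl z' →
          lab E.q s l (Sum.inl z) (Sum.inl z') = E.u (E.orig z) (E.orig z') := by
      intro a b z z' hz hz'
      by_cases hab : a = b
      · subst hab
        rw [hz] at hz'; cases hz'
        exact E.lab_inl s l (Or.inl rfl)
      · have := f2 a b hab
        rw [hz, hz'] at this
        exact E.lab_inl s l (Or.inr this)
    -- maximal level
    obtain ⟨a1, z1, hz1, hmax⟩ : ∃ a1 z1, f a1 = Sum.inl z1 ∧ ∀ b z, f b = Sum.inl z → z ≤ z1 := by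
      have hne : (Finset.univ.filter (fun a : Fin n => ∃ z, f a = Sum.inl z)).Nonempty :=
        ⟨ai, by simp [hai]⟩
      obtain ⟨a1, h1, h2⟩ := Finset.exists_max_image _ (fun a => Sum.elim id (fun _ => 0) (f a)) hne
      obtain ⟨z1, hz1⟩ := (Finset.mem_filter.1 h1).2
      refine ⟨a1, z1, hz1, fun b z hb => ?_⟩
      have := h2 b (by simp [hb])
      simpa [hb, hz1] using this
    have hlow : ∀ b z, f b = Sum.inl z → z ≠ z1 → z < z1 ∧ (E.q z1).2 z ≠ S.zero := by
      intro b z hb hzz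
      have hlt : z < z1 := lt_of_le_of_ne (hmax b z hb) hzz
      refine ⟨hlt, ?_⟩
      have hba : b ≠ a1 := by
        rintro rfl
        rw [hb] at hz1; cases hz1; exact hzz rfl
      have := f2 b a1 hba
      rw [hb, hz1] at this
      simpa [lab, hlt] using this
    obtain ⟨c, h, hh⟩ : ∃ (c : ℕ) (h : Fin n → Fin (S.K + 1)), ∀ a z, f a = Sum.inl z →
        E.lev c (h a) < k ∧ E.β c (h a) = E.orig z := by
      by_cases hp : E.pos z1 < S.K + 1
      · refine ⟨E.cell z1, fun a => if hb : ∃ z, f a = Sum.inl z ∧ E.pos z < S.K + 1 then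
          ⟨E.pos hb.choose, hb.choose_spec.2⟩ else 0, fun a z ha => ?_⟩
        have hcz : E.cell z = E.cell z1 ∧ E.pos z < S.K + 1 := by
          by_cases hzz : z = z1
          · subst hzz; exact ⟨rfl, hp⟩
          · obtain ⟨hlt, hnz⟩ := hlow a z ha hzz
            rw [E.q_ghost hp hlt] at hnz
            have hc : E.cell z = E.cell z1 := by
              by_contra hc
              rw [if_neg hc] at hnz; exact hnz rfl
            exact ⟨hc, (E.pos_lt_of hlt hc).trans hp⟩
        have hb : ∃ z, f a = Sum.inl z ∧ E.pos z < S.K + 1 := ⟨z, ha, hcz.2⟩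
        have hbz : hb.choose = z := by
          exact Sum.inl_injective (hb.choose_spec.1.symm.trans ha)
        simp only [dif_pos hb, hbz]
        rw [← hcz.1]
        refine ⟨?_, ?_⟩
        · rw [E.lev_eq]; exact f1 a z ha
        · simp [orig, hcz.2]
      · have hb : ∀ a z, f a = Sum.inl z → E.orig z ≤ E.π (E.cell z1) := by
          intro a z ha
          have ho : E.orig z1 = E.π (E.cell z1) := by simp [orig, hp]
          by_cases hzz : z = z1
          · subst hzz; exact ho.le
          · obtain ⟨hlt, hnz⟩ := hlow a z ha hzz
            rw [E.q_real hp hlt] at hnz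
            rw [← ho]
            unfold γ at hnz
            by_contra hcon
            rw [if_neg (by omega)] at hnz; exact hnz rfl
        let v : Fin (S.K + 1) → ℕ := fun i => if hi : i.1 < n then
          Sum.elim E.orig (fun _ => 0) (f ⟨i, hi⟩) else 0
        obtain ⟨c, hc, hcb⟩ := E.hβ (E.cell z1) v (by
          intro i
          by_cases hi : i.1 < n
          · simp only [v, dif_pos hi]
            rcases hfi : f ⟨i, hi⟩ with z | x
            · exact hb _ z hfi
            · exact Nat.zero_le _
          · simp [v, hi])
        refine ⟨c, fun a => ⟨a.1, by have := a.2; omega⟩, fun a z ha => ⟨?_, ?_⟩⟩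
        · have hpz : E.pos z1 = S.K + 1 := by have := E.pos_le z1; omega
          have h2 : E.lev c a.1 < z1 := by
            rw [← E.lev_eq z1, hpz]
            have := a.2
            rcases hc.eq_or_lt with rfl | hc
            · exact E.lev_lt' (by omega)
            · exact E.lev_lt (by omega) hc
          exact h2.trans (f1 a1 z1 hz1)
        · rw [hcb]
          simp [v, ha]
    -- the event is killed
    have hkill : E.Kill e p l' (fun a => E.β c (h a)) := by
      obtain ⟨k1, k2⟩ := hgen f (fun a => E.β c (h a)) (fun a x hx => hx) (by
        intro a ha
        obtain ⟨z, hz⟩ := (hp1 a).1 ha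
        exact ⟨z, hz, f1 a z hz, (hh a z hz).2.symm⟩) hlab0
      refine ⟨fun a b hab => ?_, ?_⟩
      · rw [← k1]; exact f2 a b hab
      · simp only [k1, k2] at f3; exact f3
    let ev : Ev S A := ⟨⟨n, by omega⟩, p, l'⟩
    obtain ⟨⟨h0, hh0⟩, hle⟩ := E.κ_spec e (Sum.inr ev) (c := c) ⟨h, hkill⟩
    obtain ⟨c', h', hk', hT', hlt'⟩ : ∃ (c' : ℕ) (h' : Fin n → Fin (S.K + 1)),
        E.Kill e p l' (fun a => E.β c' (h' a)) ∧ (∀ a, E.lev c' (h' a) ∈ T) ∧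
        ∀ a z, f a = Sum.inl z → E.lev c' (h' a) < k := by
      rcases hle.eq_or_lt with heq | hlt
      · exact ⟨c, h, hkill, fun a => by rw [← heq]; exact T2' _ _, fun a z hz => (hh a z hz).1⟩
      · refine ⟨E.κ e (Sum.inr ev), h0, hh0, fun a => T2' _ _, fun a z hz => ?_⟩
        exact (E.lev_lt (h0 a).2.le hlt).trans (hh a z hz).1
    let f' : Fin n → ℕ ⊕ W := fun a => Sum.elim (fun _ => Sum.inl (E.lev c' (h' a))) Sum.inr (f a)
    have hf'inl : ∀ a z, f' a = Sum.inl z → z = E.lev c' (h' a) ∧ ∃ z0, f a = Sum.inl z0 := by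
      intro a z ha
      rcases hfa : f a with z0 | x
      · simp only [f', hfa, Sum.elim_inl] at ha
        cases ha
        exact ⟨rfl, z0, rfl⟩
      · simp [f', hfa] at ha
    obtain ⟨k1, k2⟩ := hgen f' (fun a => E.β c' (h' a)) (fun a x hx => by simp [f', hx]) (by
      intro a ha
      obtain ⟨z, hz⟩ := (hp1 a).1 ha
      exact ⟨E.lev c' (h' a), by simp [f', hz], hlt' a z hz, E.orig_lev _ _⟩) (by
      intro a b z z' hz hz'
      obtain ⟨rfl, _⟩ := hf'inl a z hz
      obtain ⟨rfl, _⟩ := hf'inl b z' hz'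
      have hcell : ∀ a, E.cell (E.lev c' (h' a)) = c' := fun a => E.cell_lev (h' a).2.le
      have hpos : ∀ a, E.pos (E.lev c' (h' a)) < S.K + 1 := fun a => by
        rw [E.pos_lev (h' a).2.le]; exact (h' a).2
      rcases lt_trichotomy (E.lev c' (h' a)) (E.lev c' (h' b)) with hz | hz | hz
      · simp only [lab, hz, if_true]
        rw [E.q_ghost (hpos b) hz, hcell, hcell, if_pos rfl]
      · rw [hz]; simp [lab, E.diag]
      · simp only [lab, hz, if_true, not_lt.2 hz.le, if_false]
        rw [E.q_ghost (hpos a) hz, hcell, hcell, if_pos rfl, ← E.hsw])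
    refine hyp n f' (fun a z hz => ?_) (fun a b hab => ?_) ?_
    · obtain ⟨rfl, z0, hz0⟩ := hf'inl a z hz
      exact ⟨hlt' a z0 hz0, hT' a⟩
    · change lab E.q s l (f' a) (f' b) ≠ S.zero
      rw [k1]; exact hk'.1 a b hab
    · change S.Bad n (fun a => un E.q s (f' a)) (fun a b => lab E.q s l (f' a) (f' b))
      simp only [k1, k2]; exact hk'.2

end UExp

end BRSys

end Part8

section Part9

namespace BRSys

variable {S : BRSys}

theorem SEmb.comp2 {D : Set ℕ} {P q q' : ℕ → S.Node} {g F : ℕ → ℕ} (h : SEmb D P q g)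
    (hF : SEmb Set.univ q q' F) : SEmb D P q' (fun i => F (g i)) where
  mono i hi j hj hij := hF.mono _ trivial _ trivial (h.mono i hi j hj hij)
  un i hi := (hF.un _ trivial).trans (h.un i hi)
  lab i hi j hj hij := (hF.lab _ trivial _ trivial (h.mono i hi j hj hij)).trans (h.lab i hi j hj hij)
  agr k hk i hi j hj hki hkj ha := hF.agr _ trivial _ trivial _ trivial (h.le hk hi hki) (h.le hk hj hkj)
    (h.agr k hk i hi j hj hki hkj ha)
  ok k hk W _ w hw l h0 := hF.ok _ trivial W (fun x => g (w x))
    (fun x => ⟨trivial, h.le hk (hw x).1 (hw x).2⟩) l (h.ok k hk W w hw l h0)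

theorem SEmb.congr_left {n : ℕ} {P P' q : ℕ → S.Node} {g : ℕ → ℕ} (h : SEmb (Set.Iio n) P q g)
    (hP : ∀ i < n, P i = P' i) : SEmb (Set.Iio n) P' q g where
  mono := h.mono
  un i hi := by rw [← hP i hi]; exact h.un i hi
  lab i hi j hj hij := by rw [← hP j hj]; exact h.lab i hi j hj hij
  agr k hk i hi j hj hki hkj ha := by
    rw [← hP i hi, ← hP j hj] at ha
    exact h.agr k hk i hi j hj hki hkj ha
  ok k hk W _ w hw l h0 := by
    refine h.ok k hk W w hw l ?_
    have e : (fun x => P (w x)) = (fun x => P' (w x)) := funext fun x => hP _ (hw x).1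
    rw [e]
    have hk' : k < n := hk
    exact h0.congr_left (fun i hi => (hP i (hi.trans hk')).symm)

/-- labels between levels -/
def vlab (q : ℕ → S.Node) (i j : ℕ) : S.σ :=
  if i < j then (q j).2 i else if j < i then S.sw ((q i).2 j) else S.zero

theorem UDat.main (D : UDat S) : ∃ Ω : ℕ → S.Node, Gen Ω ∧ ∀ (A : Type) [Finite A], ∃ d : ℕ,
    ∀ (k : ℕ) (χ : (A → ℕ) → Fin k), ∃ φ : ℕ → ℕ, StrictMono φ ∧ (∀ a, (Ω (φ a)).1 = D.un0 a) ∧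
      (∀ a b, vlab Ω (φ a) (φ b) = D.u a b) ∧
      Set.ncard {c : Fin k | ∃ e : A → ℕ, χ (fun a => φ (e a)) = c} ≤ d := by
  classical
  obtain ⟨E, rfl⟩ := D.exists_exp
  obtain ⟨Ω, hΩ⟩ := exists_gen (S := S) (υ0 := E.un0 0) (by
    intro u l hb
    refine E.free 0 (fun a => a.elim0) (fun a => a.elim0) ?_
    convert hb using 1) (by
    intro u l hu hl hb
    refine E.free 1 (fun _ => 0) (fun a b hab => (hab (Subsingleton.elim _ _)).elim) ?_
    convert hb using 1
    · funext a; exact (hu a).symm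
    · funext a b; rw [hl, E.diag])
  obtain ⟨S0, hS0⟩ := exists_semb hΩ E.free_q
  refine ⟨Ω, hΩ, fun A _ => ?_⟩
  obtain ⟨N, hN⟩ := E.closure A
  have := finite_nrm (S := S) N
  let Pat : Type := Fin (N + 1) × (Fin N → {s : S.Node // Nrm N s}) × (A → Fin N)
  have : Finite Pat := by unfold Pat; infer_instance
  have := Fintype.ofFinite Pat
  refine ⟨Fintype.card Pat, fun k χ => ?_⟩
  let Pf : Pat → ℕ → S.Node := fun p i => if h : i < N then (p.2.1 ⟨i, h⟩).1 else (E.un0 0, fun _ => S.zero)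
  let χp : Pat → (ℕ → ℕ) → Fin k := fun p g =>
    χ (fun a => if (p.2.2 a).1 < p.1.1 then g (p.2.2 a).1 else 0)
  have hloc : ∀ p (g g' : ℕ → ℕ), (∀ i < p.1.1, g i = g' i) → χp p g = χp p g' := by
    intro p g g' h
    have : (fun a => if (p.2.2 a).1 < p.1.1 then g (p.2.2 a).1 else 0) =
        (fun a => if (p.2.2 a).1 < p.1.1 then g' (p.2.2 a).1 else 0) := by
      funext a
      by_cases ha : (p.2.2 a).1 < p.1.1
      · rw [if_pos ha, if_pos ha, h _ ha]
      · rw [if_neg ha, if_neg ha]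
    simp only [χp, this]
  have main : ∀ T : Finset Pat, ∃ F, SEmb Set.univ Ω Ω F ∧ ∀ p ∈ T, ∀ g g',
      SEmb (Set.Iio p.1.1) (Pf p) Ω g → SEmb (Set.Iio p.1.1) (Pf p) Ω g' →
      χp p (fun i => F (g i)) = χp p (fun i => F (g' i)) := by
    intro T
    induction T using Finset.induction_on with
    | empty => exact ⟨fun i => i, SEmb.id _ _, fun p hp => by simp at hp⟩
    | insert p T _ ih =>
      obtain ⟨F, hF, h1⟩ := ih
      obtain ⟨F', hF', h2⟩ := theorem_R hΩ (Pf p) p.1.1 (fun g => χp p (fun i => F (g i)))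
        (fun g g' h => hloc p _ _ (fun i hi => congrArg F (h i hi)))
      refine ⟨fun i => F (F' i), hF'.comp hF, fun p' hp' g g' hg hg' => ?_⟩
      rcases Finset.mem_insert.1 hp' with rfl | hp'
      · exact h2 g g' hg hg'
      · exact h1 p' hp' _ _ (hg.comp hF') (hg'.comp hF')
  obtain ⟨F, hF, h1⟩ := main Finset.univ
  have hSF := hS0.comp2 hF
  have hmono : ∀ a b, a < b → F (S0 (E.R a)) < F (S0 (E.R b)) := fun a b hab =>
    hSF.mono _ trivial _ trivial (E.R_lt hab)
  have hlab : ∀ a b, a < b → (Ω (F (S0 (E.R b)))).2 (F (S0 (E.R a))) = E.u a b := fun a b hab =>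
    (hSF.lab _ trivial _ trivial (E.R_lt hab)).trans (E.q_R_R hab)
  refine ⟨fun a => F (S0 (E.R a)), fun a b hab => hmono a b hab,
    fun a => (hSF.un _ trivial).trans (E.q_R_un a), ?_, ?_⟩
  · intro a b
    unfold vlab
    rcases lt_trichotomy a b with hab | rfl | hab
    · rw [if_pos (hmono a b hab), hlab a b hab]
    · simp [E.diag]
    · rw [if_neg (not_lt.2 (hmono b a hab).le), if_pos (hmono b a hab), hlab b a hab, ← E.hsw]
  · have hkk : ∀ e : A → ℕ, ∃ p : Pat, ∃ g, SEmb (Set.Iio p.1.1) (Pf p) Ω g ∧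
        χ (fun a => F (S0 (E.R (e a)))) = χp p (fun i => F (g i)) := by
      intro e
      obtain ⟨T, hTN, hTe, hT⟩ := hN e
      obtain ⟨g, P, hPn, hg, hgs⟩ := hT.induced
      choose i hi hgi using fun a => hgs _ (hTe a)
      let p : Pat := (⟨T.card, by omega⟩, fun j => ⟨trunc N (P j), trunc_nrm _ _⟩,
        fun a => ⟨i a, (hi a).trans_le hTN⟩)
      refine ⟨p, fun i => S0 (g i), ?_, ?_⟩
      · refine (hg.comp2 hS0).congr_left (fun j hj => ?_)
        have hjN : j < N := by omega
        simp only [Pf, dif_pos hjN, p]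
        exact (trunc_of_nrm ((hPn j).mono hjN.le)).symm
      · simp only [χp, p]
        congr 1
        funext a
        rw [if_pos (hi a), hgi a]
    choose pe ge hge hχe using hkk
    let val : Pat → Option (Fin k) := fun p => if h : ∃ e, pe e = p then
      some (χ (fun a => F (S0 (E.R (h.choose a))))) else none
    have hval : ∀ e, val (pe e) = some (χ (fun a => F (S0 (E.R (e a))))) := by
      intro e
      have hex : ∃ e', pe e' = pe e := ⟨e, rfl⟩
      simp only [val, dif_pos hex]
      congr 1
      have h2 := hex.choose_spec
      generalize hex.choose = e' at h2
      rw [hχe e', hχe e]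
      have h3 := hge e'
      have h4 := hge e
      rw [h2] at h3 ⊢
      exact h1 _ (Finset.mem_univ _) _ _ h3 h4
    have hsub : some '' {c : Fin k | ∃ e : A → ℕ, χ (fun a => F (S0 (E.R (e a)))) = c} ⊆ Set.range val := by
      rintro _ ⟨c, ⟨e, rfl⟩, rfl⟩
      exact ⟨pe e, hval e⟩
    calc Set.ncard {c : Fin k | ∃ e : A → ℕ, χ (fun a => F (S0 (E.R (e a)))) = c}
        = Set.ncard (some '' {c : Fin k | ∃ e : A → ℕ, χ (fun a => F (S0 (E.R (e a)))) = c}) :=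
          (Set.ncard_image_of_injective _ (Option.some_injective _)).symm
      _ ≤ Set.ncard (Set.range val) := Set.ncard_le_ncard hsub (Set.toFinite _)
      _ ≤ Fintype.card Pat := by
          rw [← Set.image_univ, ← Nat.card_eq_fintype_card, ← Set.ncard_univ]
          exact Set.ncard_image_le (Set.toFinite _)

end BRSys

end Part9

section Assembly

variable {L : FirstOrder.Language.{0, 0}}

/-- unary type of a vertex -/
def brU (L : FirstOrder.Language.{0, 0}) {M : Type} [L.Structure M] (x : M) :
    (L.Relations 1 → Prop) × (L.Relations 2 → Prop) :=
  (fun R => Structure.RelMap R ![x], fun R => Structure.RelMap R ![x, x])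

open Classical in
/-- binary type of a pair of vertices -/
noncomputable def brB (L : FirstOrder.Language.{0, 0}) {M : Type} [L.Structure M] (x y : M) :
    L.Relations 2 → Prop × Prop :=
  if x = y then fun _ => (False, False)
  else fun R => (Structure.RelMap R ![x, y], Structure.RelMap R ![y, x])

theorem brB_self {M : Type} [L.Structure M] (x : M) :
    brB L x x = fun _ => (False, False) := by simp [brB]

theorem brB_swap {M : Type} [L.Structure M] (x y : M) :
    brB L y x = fun R => ((brB L x y R).2, (brB L x y R).1) := by
  unfold brB
  by_cases h : x = y
  · simp [h]
  · simp [h, Ne.symm h]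

theorem br_vec1 {M : Type} (t : Fin 1 → M) : t = ![t 0] := by
  funext a; fin_cases a; rfl

theorem br_vec2 {M : Type} (t : Fin 2 → M) : t = ![t 0, t 1] := by
  funext a; fin_cases a <;> rfl

theorem brU_emb {M N : Type} [L.Structure M] [L.Structure N] (g : M ↪[L] N) (x : M) :
    brU L (g x) = brU L x := by
  unfold brU
  refine Prod.ext ?_ ?_
  · funext R
    refine propext ?_
    dsimp only
    rw [← g.map_rel R ![x] ]
    have : (⇑g ∘ ![x]) = ![g x] := by funext a; fin_cases a; rfl
    rw [this]
  · funext R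
    refine propext ?_
    dsimp only
    rw [← g.map_rel R ![x, x] ]
    have : (⇑g ∘ ![x, x]) = ![g x, g x] := by funext a; fin_cases a <;> rfl
    rw [this]

theorem brB_emb {M N : Type} [L.Structure M] [L.Structure N] (g : M ↪[L] N) (x y : M) :
    brB L (g x) (g y) = brB L x y := by
  have key : ∀ (x y : M) (R : L.Relations 2),
      Structure.RelMap R ![g x, g y] ↔ Structure.RelMap R ![x, y] := by
    intro x y R
    rw [← g.map_rel R ![x, y] ]
    have : (⇑g ∘ ![x, y]) = ![g x, g y] := by funext a; fin_cases a <;> rfl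
    rw [this]
  unfold brB
  by_cases h : x = y
  · simp [h]
  · have h' : g x ≠ g y := fun e => h (g.injective e)
    simp only [h, h', if_false]
    funext R
    rw [propext (key x y R), propext (key y x R)]

theorem br_mkEmb [L.IsRelational] (harity : ∀ n, n ≠ 1 → n ≠ 2 → IsEmpty (L.Relations n))
    {M N : Type} [L.Structure M] [L.Structure N] (g : M → N) (hg : Function.Injective g)
    (hu : ∀ x, brU L (g x) = brU L x) (hb : ∀ x y, brB L (g x) (g y) = brB L x y) :
    ∃ g' : M ↪[L] N, ∀ x, g' x = g x := by
  refine ⟨⟨⟨g, hg⟩, fun f => isEmptyElim f, ?_⟩, fun x => rfl⟩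
  intro n R t
  by_cases h1 : n = 1
  · subst h1
    have e1 : ((⟨g, hg⟩ : M ↪ N).toFun ∘ t) = ![g (t 0)] := by funext a; fin_cases a; rfl
    rw [e1]
    conv_rhs => rw [br_vec1 t]
    exact iff_of_eq (congrFun (congrArg Prod.fst (hu (t 0))) R)
  by_cases h2 : n = 2
  · subst h2
    have e1 : ((⟨g, hg⟩ : M ↪ N).toFun ∘ t) = ![g (t 0), g (t 1)] := by
      funext a; fin_cases a <;> rfl
    rw [e1]
    conv_rhs => rw [br_vec2 t]
    by_cases h : t 0 = t 1
    · rw [← h]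
      exact iff_of_eq (congrFun (congrArg Prod.snd (hu (t 0))) R)
    · have h' : g (t 0) ≠ g (t 1) := fun e => h (hg e)
      have := congrArg Prod.fst (congrFun (hb (t 0) (t 1)) R)
      simp only [brB, h, h', if_false] at this
      exact iff_of_eq this
  · exact ((harity n h1 h2).false R).elim

theorem brB_ne_of_irred (harity : ∀ n, n ≠ 1 → n ≠ 2 → IsEmpty (L.Relations n))
    {M : Type} [L.Structure M] (h : Irred L M) {x y : M} (hxy : x ≠ y) :
    brB L x y ≠ fun _ => (False, False) := by
  intro h0
  obtain ⟨n, R, t, hR, ⟨a, ha⟩, ⟨b, hb⟩⟩ := h x y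
  by_cases h1 : n = 1
  · subst h1
    exact hxy (by rw [← ha, ← hb, Subsingleton.elim a b])
  by_cases h2 : n = 2
  · subst h2
    have := congrFun h0 R
    simp only [brB, hxy, if_false, Prod.mk.injEq] at this
    rw [br_vec2 t] at hR
    fin_cases a <;> fin_cases b <;> simp only [Fin.zero_eta, Fin.mk_one] at ha hb
    · exact hxy (ha.symm.trans hb)
    · rw [ha, hb] at hR; exact this.1 ▸ hR
    · rw [ha, hb] at hR; exact this.2 ▸ hR
    · exact hxy (ha.symm.trans hb)
  · exact (harity n h1 h2).false R

/-- the combinatorial system attached to a language and a family of forbidden structures -/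
noncomputable def brSys (L : FirstOrder.Language.{0, 0}) [Finite (Σ n, L.Relations n)]
    {ι : Type} [Finite ι] (F : ι → FOStr L) : BRSys where
  υ := (L.Relations 1 → Prop) × (L.Relations 2 → Prop)
  σ := L.Relations 2 → Prop × Prop
  fυ := by
    have h : ∀ n, Finite (L.Relations n) := fun n =>
      Finite.of_injective (fun R => (⟨n, R⟩ : Σ n, L.Relations n)) (fun _ _ h => by simpa using h)
    have := h 1
    have := h 2
    infer_instance
  fσ := by
    have h : ∀ n, Finite (L.Relations n) := fun n =>
      Finite.of_injective (fun R => (⟨n, R⟩ : Σ n, L.Relations n)) (fun _ _ h => by simpa using h)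
    have := h 2
    infer_instance
  zero := fun _ => (False, False)
  sw := fun s R => ((s R).2, (s R).1)
  sw_zero := rfl
  Bad := fun n un l => ∃ (i : ι) (e : Fin n ≃ (F i).carrier),
    (∀ a, un a = brU L (e a)) ∧ ∀ a b, l a b = brB L (e a) (e b)
  K := ⨆ i, Nat.card (F i).carrier
  bad_le := by
    rintro n u l ⟨i, e, -⟩
    have h : n = Nat.card (F i).carrier := by
      rw [← Nat.card_congr e, Nat.card_fin]
    rw [h]
    exact le_ciSup (f := fun i => Nat.card (F i).carrier) (Set.finite_range _).bddAbove i

/-- the structure on the levels -/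
def brStr [L.IsRelational] (un : ℕ → (L.Relations 1 → Prop) × (L.Relations 2 → Prop))
    (lb : ℕ → ℕ → L.Relations 2 → Prop × Prop) : L.Structure ℕ where
  funMap := fun f => isEmptyElim f
  RelMap := fun {n} R t =>
    match n, R, t with
    | 1, R, t => (un (t 0)).1 R
    | 2, R, t => (t 0 = t 1 ∧ (un (t 0)).2 R) ∨ (t 0 ≠ t 1 ∧ (lb (t 0) (t 1) R).1)
    | _, _, _ => False

theorem brStr_U [L.IsRelational] (un : ℕ → (L.Relations 1 → Prop) × (L.Relations 2 → Prop))
    (lb : ℕ → ℕ → L.Relations 2 → Prop × Prop) (x : ℕ) :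
    @brU L ℕ (brStr un lb) x = un x := by
  unfold brU
  refine Prod.ext ?_ ?_
  · rfl
  · funext R
    change ((x = x ∧ (un x).2 R) ∨ (x ≠ x ∧ (lb x x R).1)) = _
    simp

theorem brStr_B [L.IsRelational] (un : ℕ → (L.Relations 1 → Prop) × (L.Relations 2 → Prop))
    (lb : ℕ → ℕ → L.Relations 2 → Prop × Prop) (h0 : ∀ x, lb x x = fun _ => (False, False))
    (hs : ∀ x y, lb y x = fun R => ((lb x y R).2, (lb x y R).1)) (x y : ℕ) :
    @brB L ℕ (brStr un lb) x y = lb x y := by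
  unfold brB
  by_cases h : x = y
  · subst h; simp [h0]
  · rw [if_neg h]
    funext R
    refine Prod.ext ?_ ?_
    · change ((x = y ∧ (un x).2 R) ∨ (x ≠ y ∧ (lb x y R).1)) = _
      simp [h]
    · change ((y = x ∧ (un y).2 R) ∨ (y ≠ x ∧ (lb y x R).1)) = _
      rw [hs x y]
      simp [Ne.symm h]

end Assembly

theorem finite_big_ramsey_degrees_binary_forbidden
    (L : FirstOrder.Language.{0, 0}) [L.IsRelational] [Finite (Σ n, L.Relations n)]
    (harity : ∀ n, n ≠ 1 → n ≠ 2 → IsEmpty (L.Relations n))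
    (ι : Type) [Finite ι] (F : ι → FOStr L)
    (hFfin : ∀ i, Finite (F i).carrier) (hFirr : ∀ i, Irred L (F i).carrier)
    (U : Type) [L.Structure U] [Countable U] [Infinite U]
    (hUfree : FFree F U)
    (hUuniv : ∀ (B : Type) [L.Structure B] [Countable B], FFree F B → Nonempty (B ↪[L] U))
    (A : L.Substructure U) (hA : (A : Set U).Finite) :
    ∃ D : ℕ, ∀ k : ℕ, 1 ≤ k → Arrow L U U A k D := by
  classical
  obtain ⟨en⟩ : Nonempty (ℕ ≃ U) := by
    obtain ⟨_⟩ := nonempty_denumerable U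
    exact ⟨(Denumerable.eqv U).symm⟩
  let S : BRSys := brSys L F
  let D : BRSys.UDat S :=
    { un0 := fun a => brU L (en a)
      u := fun a b => brB L (en a) (en b)
      diag := fun a => brB_self _
      hsw := fun a b => brB_swap _ _
      free := by
        rintro n f - ⟨i, e, hu, hb⟩
        have hne : ∀ a b, e a ≠ e b → en (f a) ≠ en (f b) := by
          intro a b hab hf
          have h1 := hb a b
          dsimp only at h1
          rw [hf, brB_self] at h1
          exact brB_ne_of_irred harity (hFirr i) hab h1.symm
        obtain ⟨g, -⟩ := br_mkEmb (L := L) harity (M := (F i).carrier) (N := U)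
          (fun x => en (f (e.symm x)))
          (by
            intro x y hxy
            by_contra hne'
            exact hne (e.symm x) (e.symm y) (by simpa using hne') hxy)
          (by
            intro x
            have := hu (e.symm x)
            simpa using this)
          (by
            intro x y
            have := hb (e.symm x) (e.symm y)
            simpa using this)
        exact (hUfree i).false g }
  obtain ⟨Ω, hΩ, hmain⟩ := D.main
  let lb : ℕ → ℕ → L.Relations 2 → Prop × Prop := fun i j => BRSys.vlab Ω i j
  have lb0 : ∀ x, lb x x = fun _ => (False, False) := by
    intro x
    simp only [lb, BRSys.vlab, lt_irrefl, if_false]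
    rfl
  have lbs : ∀ x y, lb y x = fun R => ((lb x y R).2, (lb x y R).1) := by
    intro x y
    rcases lt_trichotomy x y with h | h | h
    · simp only [lb, BRSys.vlab, h, h.not_gt, if_true, if_false]; rfl
    · subst h; rw [lb0]
    · simp only [lb, BRSys.vlab, h, h.not_gt, if_true, if_false]; rfl
  let un : ℕ → (L.Relations 1 → Prop) × (L.Relations 2 → Prop) := fun i => (Ω i).1
  let _ : L.Structure ℕ := brStr un lb
  have hU' : ∀ x : ℕ, brU L x = un x := brStr_U un lb
  have hB' : ∀ x y : ℕ, brB L x y = lb x y := brStr_B un lb lb0 lbs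
  have hfree : FFree F ℕ := by
    intro i
    refine ⟨fun g => ?_⟩
    have := hFfin i
    let e : Fin (Nat.card (F i).carrier) ≃ (F i).carrier := (Finite.equivFin _).symm
    obtain ⟨ℓ, hℓ⟩ : ∃ ℓ, ∀ a, g (e a) < ℓ := by
      obtain ⟨B, hB⟩ := (Set.finite_range (fun a => g (e a))).bddAbove
      exact ⟨B + 1, fun a => Nat.lt_succ_of_le (hB ⟨a, rfl⟩)⟩
    refine hΩ.free ℓ _ (fun a => Sum.inl (g (e a))) ?_ ?_ ⟨i, e, ?_, ?_⟩
    · rintro a i h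
      cases h
      exact hℓ a
    · intro a b hab h
      have h1 : brB L (g (e a)) (g (e b)) = fun _ => (False, False) := (hB' _ _).trans h
      rw [brB_emb] at h1
      exact brB_ne_of_irred harity (hFirr i) (fun h => hab (e.injective h)) h1
    · intro a
      exact (hU' _).symm.trans (brU_emb g (e a))
    · intro a b
      exact (hB' _ _).symm.trans (brB_emb g (e a) (e b))
  obtain ⟨j⟩ := hUuniv ℕ hfree
  have : Finite A := hA
  obtain ⟨d, hd⟩ := hmain A
  refine ⟨d, fun k hk χ => ?_⟩
  let χ' : (A → ℕ) → Fin k := fun h =>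
    if H : ∃ e : A ↪[L] U, ∀ a, e a = j (h a) then χ H.choose else ⟨0, hk⟩
  have hχ' : ∀ (h : A → ℕ) (e : A ↪[L] U), (∀ a, e a = j (h a)) → χ' h = χ e := by
    intro h e he
    have H : ∃ e : A ↪[L] U, ∀ a, e a = j (h a) := ⟨e, he⟩
    simp only [χ', dif_pos H]
    congr 1
    ext a
    rw [H.choose_spec a, he a]
  obtain ⟨φ, hφ, hφu, hφb, hcard⟩ := hd k χ'
  obtain ⟨f0, hf0⟩ := br_mkEmb (L := L) harity (M := U) (N := ℕ) (fun x => φ (en.symm x))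
    (hφ.injective.comp en.symm.injective)
    (by
      intro x
      rw [hU']
      refine (hφu (en.symm x)).trans ?_
      simp [D]
      rfl)
    (by
      intro x y
      rw [hB']
      refine (hφb (en.symm x) (en.symm y)).trans ?_
      simp [D]
      rfl)
  refine ⟨j.comp f0, le_trans (Set.ncard_le_ncard ?_ (Set.toFinite _)) hcard⟩
  rintro c ⟨e, he, rfl⟩
  have hx : ∀ a, ∃ x, (j.comp f0) x = e a := fun a => he ⟨a, rfl⟩
  choose x hx using hx
  refine ⟨fun a => en.symm (x a), hχ' _ e fun a => ?_⟩
  rw [← hx a, Embedding.comp_apply, hf0]
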